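/- Let p be an odd prime, ε ∈ ℤ_p^×, and m ≥ 2 an integer. Let L be a positive definite half-integral ternary form whose Gram matrix is ℤ_p-equivalent to H ⊕ [p^m·ε]. Set Λ_p(L) := {x ∈ ℤ³ : f_L(x+z) ≡ f_L(z) (mod p) for all z ∈ ℤ³}; then f_L takes all its values on Λ_p(L) in p²ℤ, and one defines λ_p(L) := the positive definite half-integral ternary form (1/p²)·f_L restricted to Λ_p(L) (via any ℤ-basis of Λ_p(L)). Write K := λ_p(L). Let L₁, …, L_g be pairwise non-ℤ-equivalent positive definite half-integral ternary forms such that each L_i is ℤ_q-equivalent to L at every prime q and λ_p(L_i) is ℤ-equivalent to K, and such that every positive definite half-integral ternary form with these two properties is ℤ-equivalent to some L_i. Then for every positive integer n not divisible by p: Σ_{i=1}^{g} r(n, L_i)/o(L_i) = c · r(n, K)/o(K), where c = (p − ((−n·d_K)/p))/2 if m = 2 and c = p if m ≥ 3; here d_K = det(Gram(K)), and ((−n·d_K)/p) denotes the Legendre symbol of the integer −n·4·det(Gram(K)) (which is prime to p; the factor 4 is a square and does not change the symbol). -/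

import Mathlib

open Matrix

noncomputable section

/-- The image of an integral matrix in the rational matrices. -/
def intMap (X : Matrix (Fin 3) (Fin 3) ℤ) : Matrix (Fin 3) (Fin 3) ℚ :=
  X.map fun a => (a : ℚ)

/-- The value of the quadratic form with Gram matrix `A` at an integral vector `x`. -/
def qf (A : Matrix (Fin 3) (Fin 3) ℚ) (x : Fin 3 → ℤ) : ℚ :=
  (fun i => (x i : ℚ)) ⬝ᵥ A.mulVec fun i => (x i : ℚ)

/-- A rational symmetric matrix is half-integral: integral diagonal, off-diagonal in (1/2)ℤ. -/
def HalfIntegral (A : Matrix (Fin 3) (Fin 3) ℚ) : Prop :=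
  (∀ i, ∃ n : ℤ, A i i = n) ∧ ∀ i j, ∃ n : ℤ, 2 * A i j = n

/-- `A` is symmetric and positive definite. -/
def PosDef3 (A : Matrix (Fin 3) (Fin 3) ℚ) : Prop :=
  A.IsSymm ∧ ∀ x : Fin 3 → ℚ, x ≠ 0 → 0 < x ⬝ᵥ A.mulVec x

/-- `r(K, L)`: the number of representations of the form with Gram matrix `A` by the form
with Gram matrix `B`. -/
def repNum (A B : Matrix (Fin 3) (Fin 3) ℚ) : ℕ :=
  Nat.card {X : Matrix (Fin 3) (Fin 3) ℤ // (intMap X)ᵀ * B * intMap X = A}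

/-- `o(L)`: the number of integral automorphs of the form with Gram matrix `A`. -/
def autNum (A : Matrix (Fin 3) (Fin 3) ℚ) : ℕ :=
  Nat.card {X : Matrix (Fin 3) (Fin 3) ℤ // IsUnit X.det ∧ (intMap X)ᵀ * A * intMap X = A}

/-- `r(n, f)`: the number of representations of the integer `n` by the form with
Gram matrix `A`. -/
def rEval (A : Matrix (Fin 3) (Fin 3) ℚ) (n : ℤ) : ℕ :=
  Nat.card {x : Fin 3 → ℤ // qf A x = (n : ℚ)}

/-- ℤ-equivalence of Gram matrices. -/
def ZEquiv (A B : Matrix (Fin 3) (Fin 3) ℚ) : Prop :=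
  ∃ X : Matrix (Fin 3) (Fin 3) ℤ, IsUnit X.det ∧ (intMap X)ᵀ * A * intMap X = B

/-- The Watson set `Λ_p(A) = {x ∈ ℤ³ : f_A(x + z) ≡ f_A(z) (mod p) for all z ∈ ℤ³}`. -/
def LamSet (p : ℕ) (A : Matrix (Fin 3) (Fin 3) ℚ) : Set (Fin 3 → ℤ) :=
  {x | ∀ z : Fin 3 → ℤ, ∃ k : ℤ, qf A (x + z) - qf A z = (p : ℚ) * k}

/-- ℤ_q-equivalence of rational Gram matrices (inside ℚ_q). -/
def ZqEquiv (q : ℕ) [Fact q.Prime] (A B : Matrix (Fin 3) (Fin 3) ℚ) : Prop :=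
  ∃ X : Matrix (Fin 3) (Fin 3) ℤ_[q], IsUnit X.det ∧
    (X.map fun a => (a : ℚ_[q]))ᵀ * A.map (fun a => (a : ℚ_[q])) * X.map (fun a => (a : ℚ_[q]))
      = B.map fun a => (a : ℚ_[q])

/-- ℤ_q-equivalence of a rational Gram matrix to a q-adic target matrix. -/
def ZpEquivTo (q : ℕ) [Fact q.Prime] (A : Matrix (Fin 3) (Fin 3) ℚ)
    (B : Matrix (Fin 3) (Fin 3) ℚ_[q]) : Prop :=
  ∃ X : Matrix (Fin 3) (Fin 3) ℤ_[q], IsUnit X.det ∧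
    (X.map fun a => (a : ℚ_[q]))ᵀ * A.map (fun a => (a : ℚ_[q])) * X.map (fun a => (a : ℚ_[q])) = B

/-- The block diagonal matrix `H ⊕ [c]` with `H = [[0,1/2],[1/2,0]]`. -/
def Hblock (q : ℕ) [Fact q.Prime] (c : ℚ_[q]) : Matrix (Fin 3) (Fin 3) ℚ_[q] :=
  !![0, 1/2, 0; 1/2, 0, 0; 0, 0, c]

section BinaryCount

variable {F : Type*} [Field F] [Fintype F]

lemma exists_sq_sub_mul_sq_eq (hF : ringChar F ≠ 2) {δ : F} (hδ : δ ≠ 0) (t : F) :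
    ∃ u v : F, u ^ 2 - δ * v ^ 2 = t := by
  obtain ⟨a, b, h⟩ := FiniteField.exists_root_sum_quadratic (R := F)
    (f := Polynomial.X ^ 2) (g := Polynomial.C (-δ) * Polynomial.X ^ 2 +
      Polynomial.C 0 * Polynomial.X + Polynomial.C (-t)) (by simp) (Polynomial.degree_quadratic (by simpa using hδ))
    (FiniteField.odd_card_of_char_ne_two hF)
  refine ⟨a, b, ?_⟩
  simp at h
  linear_combination h

variable [DecidableEq F]

lemma sum_quadraticChar_norm (hF : ringChar F ≠ 2) {δ : F} (hδ : δ ≠ 0) :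
    ∑ z : F × F, quadraticChar F (z.1 ^ 2 - δ * z.2 ^ 2) = 0 := by
  obtain ⟨t, ht⟩ := quadraticChar_exists_neg_one hF
  have ht0 : t ≠ 0 := by rintro rfl; simp at ht
  obtain ⟨u, v, huv⟩ := exists_sq_sub_mul_sq_eq hF hδ t
  let e : F × F → F × F := fun z => (u * z.1 + δ * v * z.2, v * z.1 + u * z.2)
  have he : Function.Bijective e := by
    rw [Finite.injective_iff_bijective.symm]
    rintro ⟨x, y⟩ ⟨x', y'⟩ h
    simp only [e, Prod.mk.injEq] at h
    obtain ⟨h1, h2⟩ := h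
    ext
    · apply mul_left_cancel₀ ht0
      simp only
      linear_combination u * h1 - δ * v * h2 - (x - x') * huv
    · apply mul_left_cancel₀ ht0
      simp only
      linear_combination u * h2 - v * h1 - (y - y') * huv
  have h := he.sum_comp (fun z : F × F => quadraticChar F (z.1 ^ 2 - δ * z.2 ^ 2))
  have h2 : ∀ z : F × F, quadraticChar F ((e z).1 ^ 2 - δ * (e z).2 ^ 2)
      = - quadraticChar F (z.1 ^ 2 - δ * z.2 ^ 2) := by
    intro z
    have : (e z).1 ^ 2 - δ * (e z).2 ^ 2 = t * (z.1 ^ 2 - δ * z.2 ^ 2) := by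
      rw [← huv]; simp only [e]; ring
    rw [this, map_mul, ht]; ring
  simp only [h2, Finset.sum_neg_distrib] at h
  linarith

lemma card_norm_eq_zero (hF : ringChar F ≠ 2) (δ : F) :
    ((Finset.univ.filter fun z : F × F => z.1 ^ 2 - δ * z.2 ^ 2 = 0).card : ℤ)
      = 1 + (Fintype.card F - 1) * (1 + quadraticChar F δ) := by
  rw [Finset.card_filter, Fintype.sum_prod_type_right]
  have h1 : ∀ y : F, ((∑ x : F, if x ^ 2 - δ * y ^ 2 = 0 then 1 else 0 : ℕ) : ℤ)
      = 1 + quadraticChar F δ * (if y = 0 then 0 else 1) := by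
    intro y
    have := quadraticChar_card_sqrts hF (δ * y ^ 2)
    rw [← Finset.card_filter]
    have h3 : (Finset.univ.filter fun x : F => x ^ 2 - δ * y ^ 2 = 0)
        = {x : F | x ^ 2 = δ * y ^ 2}.toFinset := by
      ext x; simp [sub_eq_zero]
    rw [h3, this, map_mul]
    split_ifs with hy
    · simp [hy]
    · rw [quadraticChar_sq_one' hy]; ring
  push_cast at h1 ⊢
  simp only [h1]
  rw [Finset.sum_add_distrib, ← Finset.mul_sum]
  have : ∑ y : F, (if y = 0 then (0:ℤ) else 1) = Fintype.card F - 1 := by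
    have : ∀ y : F, (if y = 0 then (0:ℤ) else 1) = 1 - if y = 0 then 1 else 0 := by
      intro y; split_ifs <;> simp
    simp [this]
  rw [this]
  simp; ring

lemma two_mul_card_quadraticChar_eq_one {ι : Type*} [Fintype ι] (g : ι → F) :
    2 * ((Finset.univ.filter fun z => quadraticChar F (g z) = 1).card : ℤ)
      = Fintype.card ι - (Finset.univ.filter fun z => g z = 0).card
        + ∑ z, quadraticChar F (g z) := by
  rw [Finset.card_filter, Finset.card_filter, Fintype.card_eq_sum_ones]
  push_cast
  rw [Finset.mul_sum, ← Finset.sum_sub_distrib, ← Finset.sum_add_distrib]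
  refine Finset.sum_congr rfl fun z _ => ?_
  by_cases hz : g z = 0
  · simp [hz]
  · rcases quadraticChar_dichotomy hz with h | h <;> simp [h, hz]

lemma two_mul_card_binary_aux (hF : ringChar F ≠ 2) {α β γ : F} (hα : α ≠ 0)
    (h : β ^ 2 - α * γ ≠ 0) :
    2 * ((Finset.univ.filter fun z : F × F =>
        quadraticChar F (α * z.1 ^ 2 + 2 * β * z.1 * z.2 + γ * z.2 ^ 2) = 1).card : ℤ)
      = (Fintype.card F - 1) * (Fintype.card F - quadraticChar F (β ^ 2 - α * γ)) := by
  set δ := β ^ 2 - α * γ with hδ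
  let e : F × F → F × F := fun z => (α * z.1 + β * z.2, z.2)
  have he : Function.Bijective e := by
    rw [Finite.injective_iff_bijective.symm]
    rintro ⟨x, y⟩ ⟨x', y'⟩ h
    simp only [e, Prod.mk.injEq] at h
    obtain ⟨h1, rfl⟩ := h
    ext
    · apply mul_left_cancel₀ hα
      simp only
      linear_combination h1
    · rfl
  have key : ∀ z : F × F, α * z.1 ^ 2 + 2 * β * z.1 * z.2 + γ * z.2 ^ 2
      = α⁻¹ * ((e z).1 ^ 2 - δ * (e z).2 ^ 2) := by
    intro z
    simp only [e, hδ]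
    field_simp
    ring
  rw [two_mul_card_quadraticChar_eq_one]
  simp only [key, map_mul]
  rw [← Finset.mul_sum, he.sum_comp (fun z : F × F => quadraticChar F (z.1 ^ 2 - δ * z.2 ^ 2)),
    sum_quadraticChar_norm hF h]
  have h3 : (Finset.univ.filter fun z : F × F => α⁻¹ * ((e z).1 ^ 2 - δ * (e z).2 ^ 2) = 0).card
      = (Finset.univ.filter fun z : F × F => z.1 ^ 2 - δ * z.2 ^ 2 = 0).card := by
    rw [Finset.card_filter, Finset.card_filter,
      ← he.sum_comp (fun z : F × F => if z.1 ^ 2 - δ * z.2 ^ 2 = 0 then 1 else 0)]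
    simp [hα]
  rw [h3, card_norm_eq_zero hF]
  simp; ring

lemma two_mul_card_binary (hF : ringChar F ≠ 2) {α β γ : F} (h : β ^ 2 - α * γ ≠ 0) :
    2 * ((Finset.univ.filter fun z : F × F =>
        quadraticChar F (α * z.1 ^ 2 + 2 * β * z.1 * z.2 + γ * z.2 ^ 2) = 1).card : ℤ)
      = (Fintype.card F - 1) * (Fintype.card F - quadraticChar F (β ^ 2 - α * γ)) := by
  by_cases hα : α = 0
  swap
  · exact two_mul_card_binary_aux hF hα h
  by_cases hγ : γ = 0
  · subst hα hγ
    have h2 : (2 : F) ≠ 0 := Ring.two_ne_zero hF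
    have hβ : β ≠ 0 := by rintro rfl; simp at h
    have := two_mul_card_binary_aux hF (α := 2 * β) (β := β) (γ := 0) (mul_ne_zero h2 hβ)
      (by simpa using hβ)
    simp only [mul_zero, zero_mul] at this ⊢
    rw [← this]
    congr 2
    refine (Finset.card_bij (fun z _ => (z.1, z.1 + z.2)) ?_ ?_ ?_).symm
    · rintro ⟨a, b⟩ hz
      simp only [Finset.mem_filter, Finset.mem_univ, true_and] at hz ⊢
      rw [← hz]; congr 1; ring
    · rintro ⟨a, b⟩ _ ⟨c, d⟩ _ hz
      simp only [Prod.mk.injEq] at hz ⊢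
      obtain ⟨rfl, h⟩ := hz
      simpa using h
    · rintro ⟨a, b⟩ hz
      simp only [Finset.mem_filter, Finset.mem_univ, true_and] at hz ⊢
      refine ⟨(a, b - a), ?_, by simp⟩
      rw [← hz]; congr 1; ring
  · have := two_mul_card_binary_aux hF (α := γ) (β := β) (γ := α) hγ
      (by rwa [mul_comm γ α])
    rw [mul_comm γ α] at this
    rw [← this]
    congr 2
    refine Finset.card_bij (fun z _ => (z.2, z.1)) ?_ ?_ ?_
    · rintro ⟨a, b⟩ hz
      simp only [Finset.mem_filter, Finset.mem_univ, true_and] at hz ⊢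
      rw [← hz]; congr 1; ring
    · rintro ⟨a, b⟩ _ ⟨c, d⟩ _ hz
      simp only [Prod.mk.injEq] at hz ⊢
      exact ⟨hz.2, hz.1⟩
    · rintro ⟨a, b⟩ hz
      simp only [Finset.mem_filter, Finset.mem_univ, true_and] at hz ⊢
      refine ⟨(b, a), ?_, rfl⟩
      rw [← hz]; congr 1; ring

lemma card_linear_eq_zero {a b : F} (h : a ≠ 0 ∨ b ≠ 0) :
    (Finset.univ.filter fun z : F × F => a * z.1 + b * z.2 = 0).card = Fintype.card F := by
  rw [← Finset.card_univ]
  symm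
  refine Finset.card_bij (fun t _ => (b * t, -a * t)) ?_ ?_ ?_
  · intro t _
    simp; ring
  · intro t _ t' _ ht
    simp only [Prod.mk.injEq] at ht
    rcases h with h | h
    · exact mul_left_cancel₀ (neg_ne_zero.mpr h) ht.2
    · exact mul_left_cancel₀ h ht.1
  · rintro ⟨x, y⟩ hz
    simp only [Finset.mem_filter, Finset.mem_univ, true_and] at hz
    by_cases ha : a = 0
    · have hb : b ≠ 0 := by tauto
      subst ha
      have hy : y = 0 := by simpa [hb] using hz
      exact ⟨b⁻¹ * x, Finset.mem_univ _, by ext <;> simp [hb, hy]⟩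
    · refine ⟨-a⁻¹ * y, Finset.mem_univ _, ?_⟩
      ext
      · simp only
        field_simp
        linear_combination -hz
      · simp only
        field_simp

lemma card_quadraticChar_linear_sq {a b : F} (h : a ≠ 0 ∨ b ≠ 0) :
    ((Finset.univ.filter fun z : F × F => quadraticChar F ((a * z.1 + b * z.2) ^ 2) = 1).card : ℤ)
      = (Fintype.card F - 1) * Fintype.card F := by
  have h2 := two_mul_card_quadraticChar_eq_one (fun z : F × F => (a * z.1 + b * z.2) ^ 2)
  have h3 : ∀ x : F, quadraticChar F (x ^ 2) = 1 - if x = 0 then 1 else 0 := by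
    intro x
    by_cases hx : x = 0
    · simp [hx]
    · rw [quadraticChar_sq_one' hx]; simp [hx]
  have h4 : ∑ z : F × F, quadraticChar F ((a * z.1 + b * z.2) ^ 2)
      = Fintype.card F * Fintype.card F - Fintype.card F := by
    simp only [h3, Finset.sum_sub_distrib]
    have := card_linear_eq_zero h
    rw [Finset.card_filter] at this
    have h5 := congrArg (Nat.cast : ℕ → ℤ) this
    push_cast at h5
    rw [h5]
    simp
  simp only [pow_eq_zero_iff two_ne_zero, card_linear_eq_zero h, h4] at h2
  simp only [Fintype.card_prod] at h2
  push_cast at h2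
  linarith

end BinaryCount

section TernaryCount

variable {F : Type*} [Field F] [Fintype F] [DecidableEq F]

lemma quadraticChar_sq_mul {a : F} (ha : a ≠ 0) (x : F) :
    quadraticChar F (a ^ 2 * x) = quadraticChar F x := by
  rw [map_mul, quadraticChar_sq_one' ha, one_mul]

lemma exists_det_ne_zero_mulVec_single {k : Type*} [Field k] {v : Fin 3 → k} (hv : v ≠ 0) :
    ∃ P : Matrix (Fin 3) (Fin 3) k, P.det ≠ 0 ∧ P *ᵥ Pi.single 0 1 = v := by
  have hv' : v 0 ≠ 0 ∨ v 1 ≠ 0 ∨ v 2 ≠ 0 := by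
    by_contra! h
    apply hv
    ext i
    fin_cases i
    exacts [h.1, h.2.1, h.2.2]
  rcases hv' with h | h | h
  · refine ⟨!![v 0, 0, 0; v 1, 1, 0; v 2, 0, 1], ?_, ?_⟩
    · simpa [det_fin_three] using h
    · ext i; fin_cases i <;> simp
  · refine ⟨!![v 0, 1, 0; v 1, 0, 0; v 2, 0, 1], ?_, ?_⟩
    · simpa [det_fin_three] using h
    · ext i; fin_cases i <;> simp
  · refine ⟨!![v 0, 1, 0; v 1, 0, 1; v 2, 0, 0], ?_, ?_⟩
    · simpa [det_fin_three] using h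
    · ext i; fin_cases i <;> simp

lemma card_filter_first_eq_zero (g : (Fin 3 → F) → Prop) [DecidablePred g] :
    (Finset.univ.filter fun ℓ : Fin 3 → F => ℓ 0 = 0 ∧ g ℓ).card
      = (Finset.univ.filter fun z : F × F => g ![0, z.1, z.2]).card := by
  symm
  refine Finset.card_bij (fun z _ => ![0, z.1, z.2]) ?_ ?_ ?_
  · intro z hz
    simpa using hz
  · rintro ⟨a, b⟩ _ ⟨c, d⟩ _ h
    have h1 := congrFun h 1
    have h2 := congrFun h 2
    simp at h1 h2
    simp [h1, h2]
  · intro ℓ hℓ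
    simp only [Finset.mem_filter, Finset.mem_univ, true_and] at hℓ
    have : ![0, ℓ 1, ℓ 2] = ℓ := by
      ext i; fin_cases i <;> simp [hℓ.1]
    exact ⟨(ℓ 1, ℓ 2), by simpa [this] using hℓ.2, this⟩

lemma eq_symm_fin_three {R : Type*} {T : Matrix (Fin 3) (Fin 3) R} (hT : T.IsSymm) :
    T = !![T 0 0, T 0 1, T 0 2; T 0 1, T 1 1, T 1 2; T 0 2, T 1 2, T 2 2] := by
  ext i j
  fin_cases i <;> fin_cases j <;> simp <;> exact hT.apply _ _

lemma card_good_of_det_ne_zero_aux (hF : ringChar F ≠ 2) {T : Matrix (Fin 3) (Fin 3) F}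
    (hT : T.IsSymm) (ht : T 0 0 ≠ 0) (hdet : T.det ≠ 0) :
    2 * ((Finset.univ.filter fun ℓ : Fin 3 → F => ℓ 0 = 0 ∧
        quadraticChar F (-(ℓ ⬝ᵥ T.adjugate *ᵥ ℓ)) = 1).card : ℤ)
      = (Fintype.card F - 1) * (Fintype.card F - quadraticChar F (-(T 0 0 * T.det))) := by
  rw [card_filter_first_eq_zero]
  have key : ∀ z : F × F, -(![0, z.1, z.2] ⬝ᵥ T.adjugate *ᵥ ![0, z.1, z.2])
      = (T 0 2 ^ 2 - T 0 0 * T 2 2) * z.1 ^ 2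
        + 2 * (T 0 0 * T 1 2 - T 0 1 * T 0 2) * z.1 * z.2
        + (T 0 1 ^ 2 - T 0 0 * T 1 1) * z.2 ^ 2 := by
    intro z
    rw [eq_symm_fin_three hT]
    simp [adjugate_fin_three, dotProduct, mulVec, Fin.sum_univ_three]
    ring
  have hd : -(T 0 0 * T.det) = (T 0 0 * T 1 2 - T 0 1 * T 0 2) ^ 2
      - (T 0 2 ^ 2 - T 0 0 * T 2 2) * (T 0 1 ^ 2 - T 0 0 * T 1 1) := by
    rw [eq_symm_fin_three hT, det_fin_three]
    simp
    ring
  simp only [key]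
  rw [hd]
  apply two_mul_card_binary hF
  rw [← hd]
  exact neg_ne_zero.mpr (mul_ne_zero ht hdet)

lemma card_good_of_det_eq_zero_aux {T : Matrix (Fin 3) (Fin 3) F}
    (hT : T.IsSymm) (ht : T 0 0 ≠ 0) (hdet : T.det = 0)
    (h0 : ∃ ℓ : Fin 3 → F, quadraticChar F (-(ℓ ⬝ᵥ T.adjugate *ᵥ ℓ)) = 1) :
    ((Finset.univ.filter fun ℓ : Fin 3 → F => ℓ 0 = 0 ∧
        quadraticChar F (-(ℓ ⬝ᵥ T.adjugate *ᵥ ℓ)) = 1).card : ℤ)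
      = (Fintype.card F - 1) * Fintype.card F := by
  obtain ⟨ℓ₀, h0⟩ := h0
  have hne : -(ℓ₀ ⬝ᵥ T.adjugate *ᵥ ℓ₀) ≠ 0 := by
    intro h; rw [h] at h0; simp at h0
  obtain ⟨s, hs⟩ := (quadraticChar_one_iff_isSquare hne).mp h0
  have hs0 : s ≠ 0 := by rintro rfl; apply hne; simpa using hs
  set w : Fin 3 → F := T.adjugate *ᵥ ℓ₀ with hw
  have hTw : T *ᵥ w = 0 := by
    rw [hw, mulVec_mulVec, mul_adjugate, hdet]; simp
  rw [card_filter_first_eq_zero]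
  have key : ∀ ℓ : Fin 3 → F, -(ℓ ⬝ᵥ T.adjugate *ᵥ ℓ) * -(ℓ₀ ⬝ᵥ T.adjugate *ᵥ ℓ₀)
      = (ℓ ⬝ᵥ w) ^ 2 := by
    intro ℓ
    have hd := hdet
    rw [hw]
    rw [eq_symm_fin_three hT] at hd ⊢
    rw [det_fin_three] at hd
    simp [adjugate_fin_three, dotProduct, mulVec, Fin.sum_univ_three] at hd ⊢
    generalize T 0 0 = a at *
    generalize T 0 1 = b at *
    generalize T 0 2 = c at *
    generalize T 1 1 = d at *
    generalize T 1 2 = e at *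
    generalize T 2 2 = f at *
    generalize ℓ 0 = x at *
    generalize ℓ 1 = y at *
    generalize ℓ 2 = z at *
    generalize ℓ₀ 0 = x' at *
    generalize ℓ₀ 1 = y' at *
    generalize ℓ₀ 2 = z' at *
    linear_combination (a * (y * z' - z * y') ^ 2 + d * (x * z' - z * x') ^ 2
      + f * (x * y' - y * x') ^ 2 + 2 * b * (y * z' - z * y') * (z * x' - x * z')
      + 2 * c * (y * z' - z * y') * (x * y' - y * x')
      + 2 * e * (z * x' - x * z') * (x * y' - y * x')) * hd
  have hw12 : w 1 ≠ 0 ∨ w 2 ≠ 0 := by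
    by_contra! h
    have h1 := congrFun hTw 0
    simp [mulVec, dotProduct, Fin.sum_univ_three, h.1, h.2, ht] at h1
    apply hne
    simp [dotProduct, Fin.sum_univ_three, h1, h.1, h.2]
  have key2 : ∀ z : F × F, quadraticChar F (-(![0, z.1, z.2] ⬝ᵥ T.adjugate *ᵥ ![0, z.1, z.2]))
      = quadraticChar F ((w 1 * z.1 + w 2 * z.2) ^ 2) := by
    intro z
    have h := key ![0, z.1, z.2]
    rw [hs] at h
    rw [← quadraticChar_sq_mul hs0]
    congr 1
    rw [show w 1 * z.1 + w 2 * z.2 = ![0, z.1, z.2] ⬝ᵥ w by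
      simp [dotProduct, Fin.sum_univ_three]; ring]
    rw [← h]; ring
  simp only [key2]
  exact card_quadraticChar_linear_sq hw12

lemma dotProduct_adjugate_congr {R : Type*} [CommRing R] (T P : Matrix (Fin 3) (Fin 3) R)
    (ℓ : Fin 3 → R) :
    (ℓ ᵥ* P) ⬝ᵥ (Pᵀ * T * P).adjugate *ᵥ (ℓ ᵥ* P) = P.det ^ 2 * (ℓ ⬝ᵥ T.adjugate *ᵥ ℓ) := by
  rw [adjugate_mul_distrib, adjugate_mul_distrib, ← mulVec_transpose P ℓ, mulVec_mulVec,
    Matrix.mul_assoc, Matrix.mul_assoc, adjugate_mul, mulVec_transpose P ℓ, ← dotProduct_mulVec,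
    mulVec_mulVec, ← Matrix.mul_assoc P, mul_adjugate]
  simp [smul_mulVec, dotProduct_smul]
  ring

lemma card_good_congr {T P : Matrix (Fin 3) (Fin 3) F} (hP : P.det ≠ 0) {v : Fin 3 → F}
    (hv : P *ᵥ Pi.single 0 1 = v) :
    (Finset.univ.filter fun ℓ : Fin 3 → F => ℓ ⬝ᵥ v = 0 ∧
        quadraticChar F (-(ℓ ⬝ᵥ T.adjugate *ᵥ ℓ)) = 1).card
      = (Finset.univ.filter fun ℓ : Fin 3 → F => ℓ 0 = 0 ∧
        quadraticChar F (-(ℓ ⬝ᵥ (Pᵀ * T * P).adjugate *ᵥ ℓ)) = 1).card := by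
  have hu : IsUnit P.det := hP.isUnit
  have key : ∀ ℓ : Fin 3 → F, (ℓ ⬝ᵥ v = 0 ∧ quadraticChar F (-(ℓ ⬝ᵥ T.adjugate *ᵥ ℓ)) = 1) ↔
      ((ℓ ᵥ* P) 0 = 0 ∧
        quadraticChar F (-((ℓ ᵥ* P) ⬝ᵥ (Pᵀ * T * P).adjugate *ᵥ (ℓ ᵥ* P))) = 1) := by
    intro ℓ
    rw [dotProduct_adjugate_congr, ← mul_neg, quadraticChar_sq_mul hP, ← hv, dotProduct_mulVec]
    simp
  refine Finset.card_bij (fun ℓ _ => ℓ ᵥ* P) ?_ ?_ ?_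
  · intro ℓ hℓ
    simp only [Finset.mem_filter, Finset.mem_univ, true_and] at hℓ ⊢
    exact (key ℓ).mp hℓ
  · intro ℓ _ ℓ' _ h
    exact vecMul_injective_of_isUnit ((isUnit_iff_isUnit_det P).mpr hu) h
  · intro ℓ hℓ
    have : (ℓ ᵥ* P⁻¹) ᵥ* P = ℓ := by
      rw [vecMul_vecMul, nonsing_inv_mul _ hu, vecMul_one]
    refine ⟨ℓ ᵥ* P⁻¹, ?_, this⟩
    simp only [Finset.mem_filter, Finset.mem_univ, true_and] at hℓ ⊢
    rw [key, this]
    exact hℓ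

lemma congr_apply_zero_zero {R : Type*} [CommRing R] {T P : Matrix (Fin 3) (Fin 3) R} {v : Fin 3 → R}
    (hv : P *ᵥ Pi.single 0 1 = v) : (Pᵀ * T * P) 0 0 = v ⬝ᵥ T *ᵥ v := by
  subst hv
  simp [Matrix.mul_apply, mulVec, dotProduct, Fin.sum_univ_three]
  ring

lemma isSymm_congr {R : Type*} [CommRing R] {T : Matrix (Fin 3) (Fin 3) R} (hT : T.IsSymm)
    (P : Matrix (Fin 3) (Fin 3) R) : (Pᵀ * T * P).IsSymm := by
  simp [IsSymm, Matrix.transpose_mul, hT.eq, Matrix.mul_assoc]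

lemma card_good_of_det_ne_zero (hF : ringChar F ≠ 2) {T : Matrix (Fin 3) (Fin 3) F}
    (hT : T.IsSymm) {v : Fin 3 → F} (ht : v ⬝ᵥ T *ᵥ v ≠ 0) (hdet : T.det ≠ 0) :
    2 * ((Finset.univ.filter fun ℓ : Fin 3 → F => ℓ ⬝ᵥ v = 0 ∧
        quadraticChar F (-(ℓ ⬝ᵥ T.adjugate *ᵥ ℓ)) = 1).card : ℤ)
      = (Fintype.card F - 1) *
        (Fintype.card F - quadraticChar F (-((v ⬝ᵥ T *ᵥ v) * T.det))) := by
  have hv : v ≠ 0 := by rintro rfl; simp at ht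
  obtain ⟨P, hP, hPv⟩ := exists_det_ne_zero_mulVec_single hv
  have h00 := congr_apply_zero_zero (T := T) hPv
  have hd : (Pᵀ * T * P).det = P.det ^ 2 * T.det := by
    rw [det_mul, det_mul, det_transpose]; ring
  rw [card_good_congr hP hPv, card_good_of_det_ne_zero_aux hF (isSymm_congr hT P)
    (by rwa [h00]) (by rw [hd]; exact mul_ne_zero (pow_ne_zero _ hP) hdet), h00, hd,
    ← quadraticChar_sq_mul hP (-((v ⬝ᵥ T *ᵥ v) * T.det))]
  congr 4
  ring

lemma card_good_of_det_eq_zero {T : Matrix (Fin 3) (Fin 3) F}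
    (hT : T.IsSymm) {v : Fin 3 → F} (ht : v ⬝ᵥ T *ᵥ v ≠ 0) (hdet : T.det = 0)
    (h0 : ∃ ℓ : Fin 3 → F, quadraticChar F (-(ℓ ⬝ᵥ T.adjugate *ᵥ ℓ)) = 1) :
    ((Finset.univ.filter fun ℓ : Fin 3 → F => ℓ ⬝ᵥ v = 0 ∧
        quadraticChar F (-(ℓ ⬝ᵥ T.adjugate *ᵥ ℓ)) = 1).card : ℤ)
      = (Fintype.card F - 1) * Fintype.card F := by
  have hv : v ≠ 0 := by rintro rfl; simp at ht
  obtain ⟨P, hP, hPv⟩ := exists_det_ne_zero_mulVec_single hv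
  have h00 := congr_apply_zero_zero (T := T) hPv
  have hd : (Pᵀ * T * P).det = P.det ^ 2 * T.det := by
    rw [det_mul, det_mul, det_transpose]; ring
  obtain ⟨ℓ, hℓ⟩ := h0
  rw [card_good_congr hP hPv, card_good_of_det_eq_zero_aux (isSymm_congr hT P)
    (by rwa [h00]) (by rw [hd, hdet, mul_zero])]
  refine ⟨ℓ ᵥ* P, ?_⟩
  rw [dotProduct_adjugate_congr, ← mul_neg, quadraticChar_sq_mul hP, hℓ]

end TernaryCount

section Padic

variable {p : ℕ} [Fact p.Prime]

lemma padicInt_isUnit_iff_toZMod_ne_zero (x : ℤ_[p]) :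
    IsUnit x ↔ PadicInt.toZMod x ≠ 0 := by
  rw [Ne, ← RingHom.mem_ker, PadicInt.ker_toZMod, IsLocalRing.mem_maximalIdeal, mem_nonunits_iff,
    not_not]

lemma padicInt_norm_lt_one_iff_toZMod_eq_zero (x : ℤ_[p]) :
    ‖x‖ < 1 ↔ PadicInt.toZMod x = 0 := by
  rw [← RingHom.mem_ker, PadicInt.ker_toZMod, IsLocalRing.mem_maximalIdeal, PadicInt.mem_nonunits]

lemma zmod_two_ne_zero (hp : p ≠ 2) : (2 : ZMod p) ≠ 0 :=
  Ring.two_ne_zero (by rwa [ZMod.ringChar_zmod_n])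

lemma padicInt_exists_sq_eq (hp : p ≠ 2) {u : ℤ_[p]} {s : ZMod p} (hs : s ≠ 0)
    (h : PadicInt.toZMod u = s ^ 2) : ∃ σ : ℤ_[p], IsUnit σ ∧ u = σ ^ 2 := by
  obtain ⟨a, rfl⟩ := ZMod.ringHom_surjective PadicInt.toZMod s
  have hd : ‖(2 * a : ℤ_[p])‖ = 1 := by
    rw [← PadicInt.isUnit_iff, padicInt_isUnit_iff_toZMod_ne_zero, map_mul, map_ofNat]
    exact mul_ne_zero (zmod_two_ne_zero hp) hs
  obtain ⟨z, hz, -⟩ := hensels_lemma (F := (Polynomial.X ^ 2 - Polynomial.C u : Polynomial ℤ_[p]))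
    (a := a) (by
      have h1 : ‖Polynomial.aeval a (Polynomial.derivative
          (Polynomial.X ^ 2 - Polynomial.C u : Polynomial ℤ_[p]))‖ = 1 := by
        rw [← hd]
        congr 1
        simp [one_add_one_eq_two]
      rw [h1, one_pow, padicInt_norm_lt_one_iff_toZMod_eq_zero]
      simp [h])
  have hzu : z ^ 2 = u := by simpa [sub_eq_zero] using hz
  refine ⟨z, ?_, hzu.symm⟩
  rw [padicInt_isUnit_iff_toZMod_ne_zero]
  intro h0
  rw [← hzu, map_pow, h0] at h
  exact hs (by simpa using h.symm)

/-- The Gram matrix (of the polar form) of the sum of a hyperbolic plane and a line. -/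
def hyperbolicSum {R : Type*} [Zero R] [One R] (c : R) : Matrix (Fin 3) (Fin 3) R :=
  !![0, 1, 0; 1, 0, 0; 0, 0, c]

lemma det_hyperbolicSum {R : Type*} [CommRing R] (c : R) : (hyperbolicSum c).det = -c := by
  simp [hyperbolicSum, det_fin_three]

/-- Complete a hyperbolic pair in the first two coordinates to a hyperbolic splitting. -/
lemma congr_hyperbolicSum_of_pair {R : Type*} [CommRing R] {T : Matrix (Fin 3) (Fin 3) R}
    (hT : T.IsSymm) {σ w c x₀ x₁ y₀ y₁ : R} (hw : IsUnit w)
    (hadj : T.adjugate 2 2 = -σ ^ 2) (hdet : T.det = -(w ^ 2 * c))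
    (hx : T 0 0 * x₀ ^ 2 + 2 * T 0 1 * x₀ * x₁ + T 1 1 * x₁ ^ 2 = 0)
    (hy : T 0 0 * y₀ ^ 2 + 2 * T 0 1 * y₀ * y₁ + T 1 1 * y₁ ^ 2 = 0)
    (hxy : T 0 0 * x₀ * y₀ + T 0 1 * (x₀ * y₁ + x₁ * y₀) + T 1 1 * x₁ * y₁ = 1) :
    ∃ X : Matrix (Fin 3) (Fin 3) R, IsUnit X.det ∧ Xᵀ * T * X = hyperbolicSum c := by
  set G := x₀ * y₁ - x₁ * y₀ with hG
  have hadj' : T 0 0 * T 1 1 - T 0 1 ^ 2 = -σ ^ 2 := by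
    rw [← hadj, adjugate_fin_three]
    simp [hT.apply 0 1]
    ring
  have hGσ : (G * σ) * (G * σ) = 1 := by
    linear_combination G ^ 2 * hadj' - hx * (T 0 0 * y₀ ^ 2 + 2 * T 0 1 * y₀ * y₁ + T 1 1 * y₁ ^ 2)
      + (T 0 0 * x₀ * y₀ + T 0 1 * (x₀ * y₁ + x₁ * y₀) + T 1 1 * x₁ * y₁ + 1) * hxy
  have hGu : IsUnit G := isUnit_of_mul_isUnit_left (IsUnit.of_mul_eq_one _ hGσ)
  obtain ⟨k, hk⟩ := (hGu.mul hw).exists_right_inv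
  have hku : IsUnit k := IsUnit.of_mul_eq_one_right _ hk
  set ex := T 0 2 * x₀ + T 1 2 * x₁ with hex
  set ey := T 0 2 * y₀ + T 1 2 * y₁ with hey
  set z₀ := -(ey * x₀ + ex * y₀) with hz₀
  set z₁ := -(ey * x₁ + ex * y₁) with hz₁
  let X : Matrix (Fin 3) (Fin 3) R := !![x₀, y₀, k * z₀; x₁, y₁, k * z₁; 0, 0, k]
  have hXdet : X.det = G * k := by
    simp [X, det_fin_three, hG]
    ring
  have e := eq_symm_fin_three hT
  obtain ⟨g, hg⟩ : ∃ g, Xᵀ * T * X = hyperbolicSum g := by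
    refine ⟨(Xᵀ * T * X) 2 2, ?_⟩
    rw [eq_symm_fin_three (isSymm_congr hT X), hyperbolicSum]
    have h00 : (Xᵀ * T * X) 0 0 = 0 := by
      rw [e]; simp [X, Matrix.mul_apply, Fin.sum_univ_three]; linear_combination hx
    have h01 : (Xᵀ * T * X) 0 1 = 1 := by
      rw [e]; simp [X, Matrix.mul_apply, Fin.sum_univ_three]; linear_combination hxy
    have h11 : (Xᵀ * T * X) 1 1 = 0 := by
      rw [e]; simp [X, Matrix.mul_apply, Fin.sum_univ_three]; linear_combination hy
    have h02 : (Xᵀ * T * X) 0 2 = 0 := by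
      rw [e]; simp [X, Matrix.mul_apply, Fin.sum_univ_three]
      linear_combination (-k * ey) * hx - k * ex * hxy
    have h12 : (Xᵀ * T * X) 1 2 = 0 := by
      rw [e]; simp [X, Matrix.mul_apply, Fin.sum_univ_three]
      linear_combination (-k * ex) * hy - k * ey * hxy
    rw [h00, h01, h11, h02, h12]
    simp
  have hdets := congrArg Matrix.det hg
  rw [det_mul, det_mul, det_transpose, hXdet, hdet, det_hyperbolicSum] at hdets
  refine ⟨X, hXdet ▸ hGu.mul hku, ?_⟩
  rw [hg]
  congr 1
  linear_combination hdets + c * (G * w * k + 1) * hk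

lemma exists_hyperbolic_pair {R : Type*} [CommRing R] (h2 : IsUnit (2 : R)) {a b c x₀ x₁ : R}
    (hx : a * x₀ ^ 2 + 2 * b * x₀ * x₁ + c * x₁ ^ 2 = 0)
    (hu : IsUnit (a * x₀ + b * x₁) ∨ IsUnit (b * x₀ + c * x₁)) :
    ∃ y₀ y₁ : R, a * y₀ ^ 2 + 2 * b * y₀ * y₁ + c * y₁ ^ 2 = 0 ∧
      a * x₀ * y₀ + b * (x₀ * y₁ + x₁ * y₀) + c * x₁ * y₁ = 1 := by
  obtain ⟨i, hi⟩ := h2.exists_right_inv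
  obtain ⟨z₀, z₁, hz⟩ : ∃ z₀ z₁ : R, (a * x₀ + b * x₁) * z₀ + (b * x₀ + c * x₁) * z₁ = 1 := by
    rcases hu with h | h <;> obtain ⟨j, hj⟩ := h.exists_right_inv
    · exact ⟨j, 0, by simpa using hj⟩
    · exact ⟨0, j, by simpa using hj⟩
  set q := i * (a * z₀ ^ 2 + 2 * b * z₀ * z₁ + c * z₁ ^ 2) with hq
  refine ⟨z₀ - q * x₀, z₁ - q * x₁, ?_, ?_⟩
  · linear_combination (q ^ 2) * hx - 2 * q * hz -
      (a * z₀ ^ 2 + 2 * b * z₀ * z₁ + c * z₁ ^ 2) * hi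
  · linear_combination hz - q * hx

lemma padicInt_isUnit_two (hp : p ≠ 2) : IsUnit (2 : ℤ_[p]) := by
  rw [padicInt_isUnit_iff_toZMod_ne_zero, map_ofNat]
  exact zmod_two_ne_zero hp

lemma padicInt_congr_hyperbolicSum (hp : p ≠ 2) {T : Matrix (Fin 3) (Fin 3) ℤ_[p]}
    (hT : T.IsSymm) {s : ZMod p} (hs : s ≠ 0)
    (hadj : PadicInt.toZMod (T.adjugate 2 2) = -s ^ 2) {w c : ℤ_[p]} (hw : IsUnit w)
    (hdet : T.det = -(w ^ 2 * c)) :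
    ∃ X : Matrix (Fin 3) (Fin 3) ℤ_[p], IsUnit X.det ∧ Xᵀ * T * X = hyperbolicSum c := by
  obtain ⟨σ, hσ, hσ2⟩ := padicInt_exists_sq_eq hp (u := -T.adjugate 2 2) hs (by simp [hadj])
  have hadj2 : T.adjugate 2 2 = -σ ^ 2 := by rw [← hσ2]; ring
  have hadj' : T 0 0 * T 1 1 - T 0 1 ^ 2 = -σ ^ 2 := by
    rw [← hadj2, adjugate_fin_three]
    simp [hT.apply 0 1]
    ring
  have main : ∀ τ : ℤ_[p], IsUnit τ → τ ^ 2 = σ ^ 2 → (IsUnit (T 0 0) ∨ IsUnit (T 0 1 - τ)) →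
      ∃ X : Matrix (Fin 3) (Fin 3) ℤ_[p], IsUnit X.det ∧ Xᵀ * T * X = hyperbolicSum c := by
    intro τ hτ hτσ h
    rw [← hτσ] at hadj'
    have hx : T 0 0 * (τ - T 0 1) ^ 2 + 2 * T 0 1 * (τ - T 0 1) * T 0 0
        + T 1 1 * T 0 0 ^ 2 = 0 := by
      linear_combination T 0 0 * hadj'
    obtain ⟨y₀, y₁, hy, hxy⟩ := exists_hyperbolic_pair (padicInt_isUnit_two hp) hx (by
      rcases h with h | h
      · left
        convert h.mul hτ using 1
        ring
      · right
        convert h.mul hτ using 1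
        linear_combination hadj')
    exact congr_hyperbolicSum_of_pair hT hw (by rw [hadj2, hτσ]) hdet hx hy hxy
  by_cases ha : IsUnit (T 0 0)
  · exact main σ hσ rfl (Or.inl ha)
  by_cases hb : IsUnit (T 0 1 - σ)
  · exact main σ hσ rfl (Or.inr hb)
  · refine main (-σ) hσ.neg (by ring) (Or.inr ?_)
    rw [padicInt_isUnit_iff_toZMod_ne_zero] at *
    simp only [not_not, map_sub, sub_eq_zero] at hb
    rw [map_sub, hb, map_neg, sub_neg_eq_add, ← two_mul]
    exact mul_ne_zero (zmod_two_ne_zero hp) hσ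

end Padic

section Reduction

variable {F : Type*} [Field F] {T P : Matrix (Fin 3) (Fin 3) F}

lemma exists_radical_of_congr (hP : IsUnit P.det) (h : Pᵀ * T * P = hyperbolicSum 0) :
    ∃ r : Fin 3 → F, r ≠ 0 ∧ ∀ y, T *ᵥ y = 0 ↔ ∃ t : F, y = t • r := by
  have hPu : IsUnit P := (isUnit_iff_isUnit_det P).mpr hP
  have hker : ∀ z : Fin 3 → F, hyperbolicSum (0 : F) *ᵥ z = 0 ↔ ∃ t : F, z = t • Pi.single 2 1 := by
    intro z
    constructor
    · intro hz
      have h0 := congrFun hz 0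
      have h1 := congrFun hz 1
      simp [hyperbolicSum, mulVec, dotProduct, Fin.sum_univ_three] at h0 h1
      refine ⟨z 2, ?_⟩
      ext i
      fin_cases i <;> simp [h0, h1]
    · rintro ⟨t, rfl⟩
      ext i
      fin_cases i <;> simp [hyperbolicSum, mulVec, dotProduct, Fin.sum_univ_three]
  refine ⟨P *ᵥ Pi.single 2 1, ?_, fun y => ?_⟩
  · intro h0
    have := mulVec_injective_of_isUnit hPu (h0.trans (mulVec_zero P).symm)
    simpa using congrFun this 2
  · have hy : y = P *ᵥ (P⁻¹ *ᵥ y) := by rw [mulVec_mulVec, mul_nonsing_inv _ hP, one_mulVec]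
    have h1 : T *ᵥ y = 0 ↔ hyperbolicSum (0 : F) *ᵥ (P⁻¹ *ᵥ y) = 0 := by
      rw [← h, ← mulVec_mulVec, ← hy, ← mulVec_mulVec]
      constructor
      · intro h2; rw [h2, mulVec_zero]
      · intro h2
        have hPt : IsUnit Pᵀ := (isUnit_iff_isUnit_det _).mpr (by rwa [det_transpose])
        exact mulVec_injective_of_isUnit hPt (h2.trans (mulVec_zero _).symm)
    rw [h1, hker]
    refine exists_congr fun t => ?_
    rw [← mulVec_smul]
    constructor
    · intro h2; rw [← h2, ← hy]
    · intro h2; rw [h2, mulVec_mulVec, nonsing_inv_mul _ hP, one_mulVec]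

lemma exists_adjugate_eq_of_congr (hP : IsUnit P.det) (h : Pᵀ * T * P = hyperbolicSum 0) :
    ∃ w : Fin 3 → F, w ≠ 0 ∧ T.adjugate = -vecMulVec w w := by
  have hN : (hyperbolicSum (0 : F)).adjugate = -vecMulVec (Pi.single 2 1) (Pi.single 2 1) := by
    ext i j
    fin_cases i <;> fin_cases j <;> simp [hyperbolicSum, adjugate_fin_three, vecMulVec_apply]
  have hT : T = (P⁻¹)ᵀ * hyperbolicSum 0 * P⁻¹ := by
    rw [← h]
    simp only [← Matrix.mul_assoc]
    rw [← transpose_mul, mul_nonsing_inv _ hP, transpose_one, Matrix.one_mul, Matrix.mul_assoc,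
      mul_nonsing_inv _ hP, Matrix.mul_one]
  have hQ : IsUnit (P⁻¹).adjugate.det := by
    rw [det_adjugate]
    exact (isUnit_nonsing_inv_det P hP).pow _
  refine ⟨(P⁻¹).adjugate *ᵥ Pi.single 2 1, ?_, ?_⟩
  · intro h0
    have := mulVec_injective_of_isUnit ((isUnit_iff_isUnit_det _).mpr hQ)
      (h0.trans (mulVec_zero _).symm)
    simpa using congrFun this 2
  · rw [hT, adjugate_mul_distrib, adjugate_mul_distrib, hN, ← adjugate_transpose]
    rw [Matrix.neg_mul, Matrix.mul_neg, vecMulVec_mul, mul_vecMulVec, vecMul_transpose]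

end Reduction

section Reduce

/-- Reduction of an integral matrix modulo `p`. -/
def modMat (p : ℕ) : Matrix (Fin 3) (Fin 3) ℤ →+* Matrix (Fin 3) (Fin 3) (ZMod p) :=
  (Int.castRingHom (ZMod p)).mapMatrix

/-- Reduction of an integral vector modulo `p`. -/
def modVec (p : ℕ) (x : Fin 3 → ℤ) : Fin 3 → ZMod p := fun i => (x i : ZMod p)

variable {p : ℕ}

lemma modMat_apply (M : Matrix (Fin 3) (Fin 3) ℤ) (i j : Fin 3) :
    modMat p M i j = (M i j : ZMod p) := rfl

lemma modVec_mulVec (M : Matrix (Fin 3) (Fin 3) ℤ) (x : Fin 3 → ℤ) :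
    modVec p (M *ᵥ x) = modMat p M *ᵥ modVec p x := by
  ext i
  exact RingHom.map_mulVec (Int.castRingHom (ZMod p)) M x i

lemma modMat_transpose (M : Matrix (Fin 3) (Fin 3) ℤ) : modMat p Mᵀ = (modMat p M)ᵀ := rfl

lemma modMat_adjugate (M : Matrix (Fin 3) (Fin 3) ℤ) :
    modMat p M.adjugate = (modMat p M).adjugate :=
  RingHom.map_adjugate _ M

lemma modMat_det (M : Matrix (Fin 3) (Fin 3) ℤ) : (modMat p M).det = (M.det : ZMod p) :=
  (RingHom.map_det (Int.castRingHom (ZMod p)) M).symm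

lemma modVec_eq_zero_iff (x : Fin 3 → ℤ) : modVec p x = 0 ↔ ∀ i, (p : ℤ) ∣ x i := by
  rw [funext_iff]
  exact forall_congr' fun i => ZMod.intCast_zmod_eq_zero_iff_dvd _ _

lemma modVec_surjective : Function.Surjective (modVec p) := fun r =>
  ⟨fun i => (ZMod.intCast_surjective (r i)).choose, funext fun i =>
    (ZMod.intCast_surjective (r i)).choose_spec⟩

lemma modMat_eq_zero_iff (M : Matrix (Fin 3) (Fin 3) ℤ) :
    modMat p M = 0 ↔ ∃ N, M = (p : ℤ) • N := by
  constructor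
  · intro h
    have : ∀ i j, (p : ℤ) ∣ M i j := fun i j =>
      (ZMod.intCast_zmod_eq_zero_iff_dvd _ _).mp (congrFun (congrFun h i) j)
    choose N hN using this
    exact ⟨Matrix.of N, by ext i j; simp [hN i j]⟩
  · rintro ⟨N, rfl⟩
    ext i j
    rw [modMat_apply, Matrix.smul_apply]
    simp

end Reduce

section Lattice

variable {p : ℕ} [Fact p.Prime]

lemma isUnit_int_det_iff {U : Matrix (Fin 3) (Fin 3) ℤ} : IsUnit U.det ↔ U.det.natAbs = 1 :=
  Int.isUnit_iff_natAbs_eq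

lemma exists_unimodular_column {r : Fin 3 → ZMod p} (hr : r ≠ 0) :
    ∃ U : Matrix (Fin 3) (Fin 3) ℤ, IsUnit U.det ∧
      ∃ t : ZMod p, t ≠ 0 ∧ modMat p U *ᵥ Pi.single 2 1 = t • r := by
  have hr' : r 0 ≠ 0 ∨ r 1 ≠ 0 ∨ r 2 ≠ 0 := by
    by_contra! h
    apply hr
    ext i
    fin_cases i
    exacts [h.1, h.2.1, h.2.2]
  rcases hr' with h | h | h
  · obtain ⟨x, hx⟩ := modVec_surjective (p := p) ((r 0)⁻¹ • r)
    refine ⟨!![0, 0, 1; 1, 0, x 1; 0, 1, x 2], by simp [det_fin_three],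
      (r 0)⁻¹, inv_ne_zero h, ?_⟩
    rw [← hx]
    ext i
    fin_cases i
    · have := congrFun hx 0
      simp [h] at this
      simp [modMat_apply, this]
    all_goals simp [modMat_apply, modVec]
  · obtain ⟨x, hx⟩ := modVec_surjective (p := p) ((r 1)⁻¹ • r)
    refine ⟨!![1, 0, x 0; 0, 0, 1; 0, 1, x 2], by simp [det_fin_three],
      (r 1)⁻¹, inv_ne_zero h, ?_⟩
    rw [← hx]
    ext i
    fin_cases i
    · simp [modMat_apply, modVec]
    · have := congrFun hx 1
      simp [h] at this
      simp [modMat_apply, this]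
    · simp [modMat_apply, modVec]
  · obtain ⟨x, hx⟩ := modVec_surjective (p := p) ((r 2)⁻¹ • r)
    refine ⟨!![1, 0, x 0; 0, 1, x 1; 0, 0, 1], by simp [det_fin_three],
      (r 2)⁻¹, inv_ne_zero h, ?_⟩
    rw [← hx]
    ext i
    fin_cases i
    · simp [modMat_apply, modVec]
    · simp [modMat_apply, modVec]
    · have := congrFun hx 2
      simp [h] at this
      simp [modMat_apply, this]

lemma exists_lattice_of_line {r : Fin 3 → ZMod p} (hr : r ≠ 0) :
    ∃ Y : Matrix (Fin 3) (Fin 3) ℤ, Y.det.natAbs = p ^ 2 ∧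
      ∀ x, (∃ t : ZMod p, modVec p x = t • r) ↔ ∃ c, x = Y *ᵥ c := by
  obtain ⟨U, hU, t, ht, htr⟩ := exists_unimodular_column hr
  refine ⟨U * diagonal ![(p : ℤ), p, 1], ?_, fun x => ⟨?_, ?_⟩⟩
  · rw [det_mul, Int.natAbs_mul, isUnit_int_det_iff.mp hU, det_diagonal]
    simp [Fin.prod_univ_three, Int.natAbs_mul, sq]
  · rintro ⟨s, hs⟩
    set z := U⁻¹ *ᵥ x with hz
    have hxz : x = U *ᵥ z := by rw [hz, mulVec_mulVec, mul_nonsing_inv _ hU, one_mulVec]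
    have hz2 : modVec p z = (s * t⁻¹) • Pi.single 2 1 := by
      have hUm : IsUnit (modMat p U) := by
        rw [isUnit_iff_isUnit_det, modMat_det]
        exact hU.map (Int.castRingHom (ZMod p))
      apply mulVec_injective_of_isUnit hUm
      rw [← modVec_mulVec, ← hxz, hs, mulVec_smul, htr, smul_smul, mul_assoc,
        inv_mul_cancel₀ ht, mul_one]
    obtain ⟨a, ha⟩ : (p : ℤ) ∣ z 0 := by
      rw [← ZMod.intCast_zmod_eq_zero_iff_dvd]
      simpa [modVec] using congrFun hz2 0
    obtain ⟨b, hb⟩ : (p : ℤ) ∣ z 1 := by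
      rw [← ZMod.intCast_zmod_eq_zero_iff_dvd]
      simpa [modVec] using congrFun hz2 1
    refine ⟨![a, b, z 2], ?_⟩
    rw [hxz, ← mulVec_mulVec]
    congr 1
    ext i
    fin_cases i <;> simp [mulVec_diagonal, ha, hb]
  · rintro ⟨c, rfl⟩
    refine ⟨(c 2 : ZMod p) * t, ?_⟩
    rw [mul_smul, ← htr, ← mulVec_smul, ← mulVec_mulVec, modVec_mulVec]
    congr 1
    ext i
    fin_cases i <;> simp [mulVec_diagonal, modVec]

lemma exists_lattice_of_hyperplane {ℓ : Fin 3 → ZMod p} (hℓ : ℓ ≠ 0) :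
    ∃ B : Matrix (Fin 3) (Fin 3) ℤ, B.det.natAbs = p ∧
      (∀ x, ℓ ⬝ᵥ modVec p x = 0 ↔ ∃ c, x = B *ᵥ c) ∧
      ∃ t : ZMod p, t ≠ 0 ∧ (modMat p B).adjugate = vecMulVec (Pi.single 2 1) (t • ℓ) := by
  obtain ⟨U, hU, t, ht, htr⟩ := exists_unimodular_column hℓ
  have hV : IsUnit (Uᵀ).det := by rwa [det_transpose]
  set V := Uᵀ with hVdef
  have hrow : ∀ x, (t • ℓ) ⬝ᵥ modVec p x = ((V *ᵥ x) 2 : ZMod p) := by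
    intro x
    rw [← htr, show ((V *ᵥ x) 2 : ZMod p) = modVec p (V *ᵥ x) 2 from rfl, modVec_mulVec, hVdef,
      modMat_transpose, mulVec_single_one]
    rfl
  refine ⟨V⁻¹ * diagonal ![1, 1, (p : ℤ)], ?_, fun x => ⟨fun h => ?_, ?_⟩, ?_⟩
  · rw [det_mul, Int.natAbs_mul, isUnit_int_det_iff.mp (isUnit_nonsing_inv_det _ hV), det_diagonal]
    simp [Fin.prod_univ_three]
  · obtain ⟨a, ha⟩ : (p : ℤ) ∣ (V *ᵥ x) 2 := by
      rw [← ZMod.intCast_zmod_eq_zero_iff_dvd, ← hrow, smul_dotProduct, h, smul_zero]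
    refine ⟨![(V *ᵥ x) 0, (V *ᵥ x) 1, a], ?_⟩
    have hxz : x = V⁻¹ *ᵥ (V *ᵥ x) := by rw [mulVec_mulVec, nonsing_inv_mul _ hV, one_mulVec]
    rw [← mulVec_mulVec]
    conv_lhs => rw [hxz]
    congr 1
    ext i
    fin_cases i <;> simp [mulVec_diagonal, ha]
  · rintro ⟨c, rfl⟩
    have h := hrow ((V⁻¹ * diagonal ![1, 1, (p : ℤ)]) *ᵥ c)
    rw [mulVec_mulVec, ← Matrix.mul_assoc, mul_nonsing_inv _ hV, Matrix.one_mul, mulVec_diagonal,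
      smul_dotProduct] at h
    simpa [ht] using h
  · have hadj : V⁻¹.adjugate = V⁻¹.det • V := by
      have : V⁻¹.adjugate = V⁻¹.adjugate * (V⁻¹ * V) := by
        rw [nonsing_inv_mul _ hV, Matrix.mul_one]
      rw [this, ← Matrix.mul_assoc, adjugate_mul, Matrix.smul_mul, Matrix.one_mul]
    have hu : ((V⁻¹.det : ℤ) : ZMod p) ≠ 0 :=
      ((isUnit_nonsing_inv_det V hV).map (Int.castRingHom (ZMod p))).ne_zero
    have hD : (diagonal ![1, 1, (p : ℤ)]).adjugate = diagonal ![(p : ℤ), p, 1] := by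
      ext i j
      fin_cases i <;> fin_cases j <;> simp [-adjugate_diagonal, adjugate_fin_three]
    refine ⟨(V⁻¹.det : ZMod p) * t, mul_ne_zero hu ht, ?_⟩
    rw [← modMat_adjugate, adjugate_mul_distrib, hadj, mul_smul, ← htr, hD]
    ext i j
    rw [modMat_apply, diagonal_mul, Matrix.smul_apply, hVdef, transpose_apply, mulVec_single_one,
      vecMulVec_apply]
    fin_cases i <;> simp [modMat_apply]

lemma exists_eq_mul_of_columns {Y Y₀ : Matrix (Fin 3) (Fin 3) ℤ}
    (h : ∀ c, ∃ c', Y *ᵥ c = Y₀ *ᵥ c') : ∃ V, Y = Y₀ * V := by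
  choose f hf using h
  refine ⟨Matrix.of fun i j => f (Pi.single j 1) i, ?_⟩
  ext i j
  have := congrFun (hf (Pi.single j 1)) i
  simp only [mulVec_single_one, col_apply] at this
  rw [this]
  simp [Matrix.mul_apply, mulVec, dotProduct]

lemma exists_unimodular_of_same_image {Y Y₀ : Matrix (Fin 3) (Fin 3) ℤ} (h0 : Y₀.det ≠ 0)
    (h : ∀ x, (∃ c, x = Y *ᵥ c) ↔ ∃ c, x = Y₀ *ᵥ c) : ∃ V, IsUnit V.det ∧ Y = Y₀ * V := by
  obtain ⟨V, hV⟩ := exists_eq_mul_of_columns fun c => (h (Y *ᵥ c)).mp ⟨c, rfl⟩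
  obtain ⟨W, hW⟩ := exists_eq_mul_of_columns fun c => (h (Y₀ *ᵥ c)).mpr ⟨c, rfl⟩
  refine ⟨V, ?_, hV⟩
  have h1 := congrArg det hV
  have h2 := congrArg det hW
  rw [det_mul] at h1 h2
  rw [h1, mul_assoc] at h2
  have h3 : V.det * W.det = 1 := by
    apply mul_left_cancel₀ h0
    rw [mul_one, ← h2]
  exact IsUnit.of_mul_eq_one _ h3

end Lattice

section Polar

variable {A A' : Matrix (Fin 3) (Fin 3) ℚ} {T T' : Matrix (Fin 3) (Fin 3) ℤ}

lemma intMap_mul (X Y : Matrix (Fin 3) (Fin 3) ℤ) : intMap (X * Y) = intMap X * intMap Y :=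
  map_mul (Int.castRingHom ℚ).mapMatrix X Y

lemma intMap_transpose (X : Matrix (Fin 3) (Fin 3) ℤ) : intMap Xᵀ = (intMap X)ᵀ := rfl

lemma intMap_apply (X : Matrix (Fin 3) (Fin 3) ℤ) (i j : Fin 3) : intMap X i j = X i j := rfl

lemma intMap_smul (n : ℤ) (X : Matrix (Fin 3) (Fin 3) ℤ) : intMap (n • X) = (n : ℚ) • intMap X := by
  ext i j
  rw [intMap_apply, Matrix.smul_apply, Matrix.smul_apply, intMap_apply]
  simp

lemma intMap_injective : Function.Injective intMap :=
  Matrix.map_injective Int.cast_injective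

lemma intMap_det (X : Matrix (Fin 3) (Fin 3) ℤ) : (intMap X).det = X.det :=
  (RingHom.map_det (Int.castRingHom ℚ) X).symm

lemma intMap_mulVec (X : Matrix (Fin 3) (Fin 3) ℤ) (x : Fin 3 → ℤ) :
    (intMap X *ᵥ fun i => (x i : ℚ)) = fun i => ((X *ᵥ x) i : ℚ) := by
  ext i
  exact (RingHom.map_mulVec (Int.castRingHom ℚ) X x i).symm

lemma exists_polar (hA : PosDef3 A) (hAh : HalfIntegral A) :
    ∃ T : Matrix (Fin 3) (Fin 3) ℤ, T.IsSymm ∧ intMap T = (2 : ℚ) • A := by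
  choose f hf using hAh.2
  have h : intMap (Matrix.of f) = (2 : ℚ) • A := by
    ext i j
    rw [Matrix.smul_apply, smul_eq_mul, hf, intMap_apply, of_apply]
  refine ⟨Matrix.of f, ?_, h⟩
  apply intMap_injective
  rw [intMap_transpose, h, transpose_smul, hA.1.eq]

lemma congr_iff_polar (h : intMap T = (2 : ℚ) • A) (h' : intMap T' = (2 : ℚ) • A')
    (X : Matrix (Fin 3) (Fin 3) ℤ) :
    (intMap X)ᵀ * A * intMap X = A' ↔ Xᵀ * T * X = T' := by
  rw [← intMap_injective.eq_iff, intMap_mul, intMap_mul, intMap_transpose, h, h',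
    Matrix.mul_smul, Matrix.smul_mul]
  exact (smul_right_injective _ two_ne_zero).eq_iff.symm

lemma two_mul_qf (h : intMap T = (2 : ℚ) • A) (x : Fin 3 → ℤ) :
    2 * qf A x = ((x ⬝ᵥ T *ᵥ x : ℤ) : ℚ) := by
  have h1 : ((x ⬝ᵥ T *ᵥ x : ℤ) : ℚ) = (fun i => (x i : ℚ)) ⬝ᵥ intMap T *ᵥ fun i => (x i : ℚ) := by
    rw [intMap_mulVec]
    simp [dotProduct]
  rw [h1, h, smul_mulVec, dotProduct_smul, smul_eq_mul, qf]

lemma qf_eq_iff (h : intMap T = (2 : ℚ) • A) (x : Fin 3 → ℤ) (n : ℤ) :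
    qf A x = n ↔ x ⬝ᵥ T *ᵥ x = 2 * n := by
  rw [← mul_right_inj' (two_ne_zero (α := ℚ)), two_mul_qf h]
  exact_mod_cast Iff.rfl

lemma dotProduct_mulVec_congr {R : Type*} [CommRing R] (T X : Matrix (Fin 3) (Fin 3) R)
    (x : Fin 3 → R) :
    x ⬝ᵥ (Xᵀ * T * X) *ᵥ x = (X *ᵥ x) ⬝ᵥ T *ᵥ (X *ᵥ x) := by
  rw [← mulVec_mulVec, ← mulVec_mulVec, dotProduct_mulVec, vecMul_transpose]

lemma dotProduct_mulVec_add {R : Type*} [CommRing R] {T : Matrix (Fin 3) (Fin 3) R}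
    (hT : T.IsSymm) (x z : Fin 3 → R) :
    (x + z) ⬝ᵥ T *ᵥ (x + z) = x ⬝ᵥ T *ᵥ x + 2 * (z ⬝ᵥ T *ᵥ x) + z ⬝ᵥ T *ᵥ z := by
  have : x ⬝ᵥ T *ᵥ z = z ⬝ᵥ T *ᵥ x := by
    rw [dotProduct_mulVec, ← mulVec_transpose, hT.eq, dotProduct_comm]
  rw [mulVec_add, add_dotProduct, dotProduct_add, dotProduct_add, this]
  ring

lemma exists_qf_eq_int (hA : PosDef3 A) (hAh : HalfIntegral A) (x : Fin 3 → ℤ) :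
    ∃ k : ℤ, qf A x = k := by
  obtain ⟨h1, h2⟩ := hAh
  obtain ⟨a, ha⟩ := h1 0
  obtain ⟨b, hb⟩ := h1 1
  obtain ⟨c, hc⟩ := h1 2
  obtain ⟨d, hd⟩ := h2 0 1
  obtain ⟨e, he⟩ := h2 0 2
  obtain ⟨f, hf⟩ := h2 1 2
  refine ⟨a * x 0 ^ 2 + b * x 1 ^ 2 + c * x 2 ^ 2 + d * x 0 * x 1 + e * x 0 * x 2
    + f * x 1 * x 2, ?_⟩
  rw [qf, eq_symm_fin_three hA.1]
  simp only [dotProduct, mulVec, Fin.sum_univ_three, of_apply, cons_val', cons_val_zero,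
    cons_val_one, cons_val]
  push_cast
  rw [← ha, ← hb, ← hc, ← hd, ← he, ← hf]
  ring

lemma mem_LamSet_iff {p : ℕ} [Fact p.Prime] (hp : p ≠ 2) (hA : PosDef3 A) (hAh : HalfIntegral A)
    (hT : T.IsSymm) (h : intMap T = (2 : ℚ) • A) (x : Fin 3 → ℤ) :
    x ∈ LamSet p A ↔ modMat p T *ᵥ modVec p x = 0 := by
  have hcop : IsCoprime (p : ℤ) 2 := by
    exact_mod_cast Nat.isCoprime_iff_coprime.mpr
      ((Nat.coprime_primes Fact.out Nat.prime_two).mpr hp)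
  rw [← modVec_mulVec, modVec_eq_zero_iff]
  have hsub : ∀ z, 2 * (qf A (x + z) - qf A z)
      = ((x ⬝ᵥ T *ᵥ x + 2 * (z ⬝ᵥ T *ᵥ x) : ℤ) : ℚ) := by
    intro z
    rw [mul_sub, two_mul_qf h, two_mul_qf h, dotProduct_mulVec_add hT]
    push_cast
    ring
  constructor
  · intro hx i
    have key : ∀ z, (p : ℤ) ∣ x ⬝ᵥ T *ᵥ x + 2 * (z ⬝ᵥ T *ᵥ x) := by
      intro z
      obtain ⟨k, hk⟩ := hx z
      refine ⟨2 * k, ?_⟩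
      have := hsub z
      rw [hk] at this
      have h2 : (2 * ((p : ℤ) * k) : ℤ) = x ⬝ᵥ T *ᵥ x + 2 * (z ⬝ᵥ T *ᵥ x) := by exact_mod_cast this
      rw [← h2]; ring
    have h0 := key 0
    have h1 := key (Pi.single i 1)
    rw [zero_dotProduct, mul_zero, add_zero] at h0
    have h2 := (dvd_add_right h0).mp h1
    simpa using hcop.dvd_of_dvd_mul_left h2
  · intro hx z
    have hdvd : ∀ z : Fin 3 → ℤ, (p : ℤ) ∣ z ⬝ᵥ T *ᵥ x := fun z =>
      Finset.dvd_sum fun i _ => (hx i).mul_left _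
    obtain ⟨a, ha⟩ := exists_qf_eq_int hA hAh x
    have hqx : x ⬝ᵥ T *ᵥ x = 2 * a := (qf_eq_iff h x a).mp ha
    obtain ⟨b, hb⟩ : (p : ℤ) ∣ a := hcop.dvd_of_dvd_mul_left (hqx ▸ hdvd x)
    obtain ⟨c, hc⟩ := hdvd z
    refine ⟨b + c, ?_⟩
    have := hsub z
    rw [hqx, hb, hc] at this
    push_cast at this ⊢
    linarith

end Polar

section Finiteness

variable {A : Matrix (Fin 3) (Fin 3) ℚ}

lemma PosDef3.det_ne_zero (hA : PosDef3 A) : A.det ≠ 0 := by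
  intro h
  obtain ⟨v, hv, hv0⟩ := exists_mulVec_eq_zero_iff.mpr h
  have := hA.2 v hv
  rw [hv0] at this
  simp at this

lemma PosDef3.exists_bound (hA : PosDef3 A) (q : ℚ) (i : Fin 3) :
    ∃ N : ℤ, ∀ x : Fin 3 → ℤ, qf A x = q → x i ∈ Set.Icc (-N) N := by
  have hd := hA.det_ne_zero
  set d := A.det with hdd
  set y : Fin 3 → ℚ := A.adjugate *ᵥ Pi.single i 1 with hy
  have hAy : A *ᵥ y = d • Pi.single i 1 := by
    rw [hy, mulVec_mulVec, mul_adjugate, smul_mulVec, one_mulVec]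
  have hy0 : y ≠ 0 := by
    intro h
    rw [h, mulVec_zero] at hAy
    have := congrFun hAy i
    simp at this
    exact hd this.symm
  set c := y ⬝ᵥ A *ᵥ y with hc
  have hcpos : 0 < c := hA.2 y hy0
  obtain ⟨N, hN⟩ := exists_nat_ge (c * q / d ^ 2)
  refine ⟨N, fun x hx => ?_⟩
  set X : Fin 3 → ℚ := fun i => (x i : ℚ) with hX
  have hXy : X ⬝ᵥ A *ᵥ y = X i * d := by
    rw [hAy, dotProduct_smul, dotProduct_single]; simp [mul_comm]
  have hyX : y ⬝ᵥ A *ᵥ X = X i * d := by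
    rw [← hXy, dotProduct_mulVec, ← mulVec_transpose, hA.1.eq, dotProduct_comm]
  have hqX : X ⬝ᵥ A *ᵥ X = q := hx
  have hnonneg : 0 ≤ (c • X - (X i * d) • y) ⬝ᵥ A *ᵥ (c • X - (X i * d) • y) := by
    by_cases h : c • X - (X i * d) • y = 0
    · rw [h]; simp
    · exact (hA.2 _ h).le
  have hexp : (c • X - (X i * d) • y) ⬝ᵥ A *ᵥ (c • X - (X i * d) • y)
      = c * (c * q - X i ^ 2 * d ^ 2) := by
    simp only [mulVec_sub, mulVec_smul, sub_dotProduct, dotProduct_sub, smul_dotProduct,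
      dotProduct_smul, hXy, hyX, hqX, ← hc, smul_eq_mul]
    ring
  rw [hexp] at hnonneg
  have h1 : X i ^ 2 * d ^ 2 ≤ c * q := by
    have := nonneg_of_mul_nonneg_right hnonneg hcpos
    linarith
  have h2 : (x i : ℚ) ^ 2 ≤ N := by
    refine le_trans ?_ hN
    rw [le_div_iff₀ (by positivity)]
    exact h1
  have h3 : x i ^ 2 ≤ (N : ℤ) := by exact_mod_cast h2
  constructor <;> nlinarith

lemma PosDef3.finite_rep (hA : PosDef3 A) (q : ℚ) : Finite {x : Fin 3 → ℤ // qf A x = q} := by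
  choose N hN using hA.exists_bound q
  have : ({x | qf A x = q} : Set (Fin 3 → ℤ)) ⊆ Set.Icc (-N) N := fun x hx =>
    ⟨fun i => (hN i x hx).1, fun i => (hN i x hx).2⟩
  exact ((Set.finite_Icc (-N) N).subset this).to_subtype

lemma PosDef3.finite_aut (hA : PosDef3 A) :
    Finite {X : Matrix (Fin 3) (Fin 3) ℤ // IsUnit X.det ∧ (intMap X)ᵀ * A * intMap X = A} := by
  have := fun j => hA.finite_rep (A j j)
  let f : {X : Matrix (Fin 3) (Fin 3) ℤ // IsUnit X.det ∧ (intMap X)ᵀ * A * intMap X = A} →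
      ∀ j : Fin 3, {x : Fin 3 → ℤ // qf A x = A j j} := fun X j =>
    ⟨fun i => X.1 i j, by
      rw [qf]
      conv_rhs => rw [← X.2.2]
      rw [Matrix.mul_assoc, Matrix.mul_apply]
      simp only [dotProduct, transpose_apply, intMap_apply, mulVec, Matrix.mul_apply]⟩
  refine Finite.of_injective f fun X Y h => ?_
  ext i j
  exact congrFun (congrArg Subtype.val (congrFun h j)) i

lemma PosDef3.autNum_ne_zero (hA : PosDef3 A) : autNum A ≠ 0 := by
  have := hA.finite_aut
  have : Nonempty {X : Matrix (Fin 3) (Fin 3) ℤ //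
      IsUnit X.det ∧ (intMap X)ᵀ * A * intMap X = A} :=
    ⟨⟨1, by simp, by simp [intMap]⟩⟩
  exact Nat.card_pos.ne'

end Finiteness

section LocalPolar

/-- The image of an integral matrix in the `p`-adic integral matrices. -/
noncomputable def padMat (p : ℕ) [Fact p.Prime] :
    Matrix (Fin 3) (Fin 3) ℤ →+* Matrix (Fin 3) (Fin 3) ℤ_[p] :=
  (Int.castRingHom ℤ_[p]).mapMatrix

variable {p : ℕ} [Fact p.Prime] {A A' : Matrix (Fin 3) (Fin 3) ℚ}
  {T T' : Matrix (Fin 3) (Fin 3) ℤ}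

lemma padMat_apply (M : Matrix (Fin 3) (Fin 3) ℤ) (i j : Fin 3) :
    padMat p M i j = (M i j : ℤ_[p]) := rfl

lemma padMat_transpose (M : Matrix (Fin 3) (Fin 3) ℤ) : padMat p Mᵀ = (padMat p M)ᵀ := rfl

lemma padMat_det (M : Matrix (Fin 3) (Fin 3) ℤ) : (padMat p M).det = (M.det : ℤ_[p]) :=
  (RingHom.map_det (Int.castRingHom ℤ_[p]) M).symm

/-- The entrywise inclusion of `ℤ_p`-matrices into `ℚ_p`-matrices. -/
noncomputable def padicCoe (p : ℕ) [Fact p.Prime] :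
    Matrix (Fin 3) (Fin 3) ℤ_[p] →+* Matrix (Fin 3) (Fin 3) ℚ_[p] :=
  (PadicInt.Coe.ringHom (p := p)).mapMatrix

lemma padicCoe_injective : Function.Injective (padicCoe p) :=
  Matrix.map_injective Subtype.val_injective

lemma padicCoe_transpose (X : Matrix (Fin 3) (Fin 3) ℤ_[p]) :
    padicCoe p Xᵀ = (padicCoe p X)ᵀ := rfl

lemma padicCoe_padMat (h : intMap T = (2 : ℚ) • A) :
    padicCoe p (padMat p T) = (2 : ℚ_[p]) • A.map (fun a => (a : ℚ_[p])) := by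
  ext i j
  have h1 := congrFun (congrFun h i) j
  rw [intMap_apply, Matrix.smul_apply, smul_eq_mul] at h1
  have h2 : ((T i j : ℤ) : ℚ_[p]) = 2 * ((A i j : ℚ) : ℚ_[p]) := by
    have := congrArg (fun a : ℚ => (a : ℚ_[p])) h1
    push_cast at this
    exact this
  rw [Matrix.smul_apply, smul_eq_mul, map_apply, ← h2]
  simp [padicCoe, padMat]

lemma padic_congr_iff (h : intMap T = (2 : ℚ) • A) (S : Matrix (Fin 3) (Fin 3) ℤ_[p])
    (B : Matrix (Fin 3) (Fin 3) ℚ_[p]) (hS : padicCoe p S = (2 : ℚ_[p]) • B)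
    (X : Matrix (Fin 3) (Fin 3) ℤ_[p]) :
    (X.map fun a => (a : ℚ_[p]))ᵀ * A.map (fun a => (a : ℚ_[p])) * X.map (fun a => (a : ℚ_[p])) = B
      ↔ Xᵀ * padMat p T * X = S := by
  rw [← padicCoe_injective.eq_iff, map_mul, map_mul, padicCoe_transpose, padicCoe_padMat h, hS,
    Matrix.mul_smul, Matrix.smul_mul]
  exact (smul_right_injective _ two_ne_zero).eq_iff.symm

lemma zqEquiv_iff (h : intMap T = (2 : ℚ) • A) (h' : intMap T' = (2 : ℚ) • A') :
    ZqEquiv p A A' ↔ ∃ X : Matrix (Fin 3) (Fin 3) ℤ_[p], IsUnit X.det ∧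
      Xᵀ * padMat p T * X = padMat p T' :=
  exists_congr fun X => and_congr_right fun _ =>
    padic_congr_iff h _ _ (padicCoe_padMat h') X

lemma zpEquivTo_Hblock_iff (h : intMap T = (2 : ℚ) • A) (c : ℤ_[p]) :
    ZpEquivTo p A (Hblock p c) ↔ ∃ X : Matrix (Fin 3) (Fin 3) ℤ_[p], IsUnit X.det ∧
      Xᵀ * padMat p T * X = hyperbolicSum (2 * c) :=
  exists_congr fun X => and_congr_right fun _ => by
    refine padic_congr_iff h _ _ ?_ X
    ext i j
    fin_cases i <;> fin_cases j <;> simp [padicCoe, hyperbolicSum, Hblock, map_ofNat]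
    rfl

lemma modMat_congr_of_padMat_congr {X : Matrix (Fin 3) (Fin 3) ℤ_[p]} {c : ℤ_[p]}
    (hX : IsUnit X.det) (h : Xᵀ * padMat p T * X = hyperbolicSum c)
    (hc : PadicInt.toZMod c = 0) :
    ∃ P : Matrix (Fin 3) (Fin 3) (ZMod p), IsUnit P.det ∧
      Pᵀ * modMat p T * P = hyperbolicSum 0 := by
  refine ⟨(PadicInt.toZMod (p := p)).mapMatrix X, ?_, ?_⟩
  · rw [← RingHom.map_det]
    exact hX.map _
  · have hT : modMat p T = (PadicInt.toZMod (p := p)).mapMatrix (padMat p T) := by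
      ext i j
      simp [modMat_apply, padMat_apply]
    have := congrArg (PadicInt.toZMod (p := p)).mapMatrix h
    rw [map_mul, map_mul, ← hT] at this
    refine this.trans ?_
    ext i j
    fin_cases i <;> fin_cases j <;> simp [hyperbolicSum, hc]

end LocalPolar

section Embeddings

variable {p : ℕ} [Fact p.Prime]

/-- The columns of `Y` span the lattice of all `x` whose reduction lies in the radical of the
reduction of `T` modulo `p`. -/
def IsRadicalBasis (p : ℕ) (T Y : Matrix (Fin 3) (Fin 3) ℤ) : Prop :=
  ∀ x, modMat p T *ᵥ modVec p x = 0 ↔ ∃ c, x = Y *ᵥ c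

/-- The reduction of `T` modulo `p` is equivalent to a hyperbolic plane plus a
one-dimensional radical. -/
def IsModHyperbolic (p : ℕ) (T : Matrix (Fin 3) (Fin 3) ℤ) : Prop :=
  ∃ P : Matrix (Fin 3) (Fin 3) (ZMod p), IsUnit P.det ∧ Pᵀ * modMat p T * P = hyperbolicSum 0

lemma natAbs_det_ne_zero {X : Matrix (Fin 3) (Fin 3) ℤ} {k : ℕ} (hX : X.det.natAbs = p ^ k) :
    X.det ≠ 0 := by
  rw [← Int.natAbs_ne_zero, hX]
  exact pow_ne_zero _ (Fact.out : p.Prime).ne_zero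

lemma IsModHyperbolic.exists_isRadicalBasis {T : Matrix (Fin 3) (Fin 3) ℤ}
    (hT : IsModHyperbolic p T) : ∃ Y, Y.det.natAbs = p ^ 2 ∧ IsRadicalBasis p T Y := by
  obtain ⟨P, hP, h⟩ := hT
  obtain ⟨r, hr, hr'⟩ := exists_radical_of_congr hP h
  obtain ⟨Y, hY, hY'⟩ := exists_lattice_of_line hr
  exact ⟨Y, hY, fun x => (hr' _).trans (hY' x)⟩

lemma IsRadicalBasis.natAbs_det {T Y : Matrix (Fin 3) (Fin 3) ℤ} (hT : IsModHyperbolic p T)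
    (hY : IsRadicalBasis p T Y) : Y.det.natAbs = p ^ 2 := by
  obtain ⟨Y₀, hd, hY₀⟩ := hT.exists_isRadicalBasis
  obtain ⟨V, hV, rfl⟩ := exists_unimodular_of_same_image (natAbs_det_ne_zero hd)
    fun x => (hY x).symm.trans (hY₀ x)
  rw [det_mul, Int.natAbs_mul, isUnit_int_det_iff.mp hV, hd, mul_one]

lemma IsRadicalBasis.exists_mul_eq {T Y : Matrix (Fin 3) (Fin 3) ℤ} (hT : IsModHyperbolic p T)
    (hY : IsRadicalBasis p T Y) :
    ∃ Z : Matrix (Fin 3) (Fin 3) ℤ, Y * Z = (p : ℤ) • (1 : Matrix (Fin 3) (Fin 3) ℤ) ∧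
      Z.det.natAbs = p := by
  obtain ⟨Z, hZ⟩ : ∃ Z, (p : ℤ) • (1 : Matrix (Fin 3) (Fin 3) ℤ) = Y * Z := by
    refine exists_eq_mul_of_columns fun c => (hY _).mp ?_
    have : modVec p (((p : ℤ) • (1 : Matrix (Fin 3) (Fin 3) ℤ)) *ᵥ c) = 0 := by
      rw [modVec_eq_zero_iff]
      intro i
      rw [smul_mulVec, one_mulVec]
      exact dvd_mul_right _ _
    rw [this, mulVec_zero]
  refine ⟨Z, hZ.symm, ?_⟩
  have hp := (Fact.out : p.Prime).pos
  have h := congrArg (fun M => Int.natAbs (det M)) hZ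
  simp only [det_smul, det_mul, Int.natAbs_mul, hY.natAbs_det hT, Fintype.card_fin, det_one,
    mul_one, Int.natAbs_pow, Int.natAbs_natCast] at h
  exact Nat.eq_of_mul_eq_mul_left (pow_pos hp 2) (by rw [← h]; ring)

lemma IsRadicalBasis.mul_unimodular {q : ℕ} {T Y V : Matrix (Fin 3) (Fin 3) ℤ} (hV : IsUnit V.det)
    (hY : IsRadicalBasis q T Y) : IsRadicalBasis q T (Y * V) := by
  intro x
  rw [hY x]
  constructor
  · rintro ⟨c, rfl⟩
    refine ⟨V⁻¹ *ᵥ c, ?_⟩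
    rw [mulVec_mulVec, Matrix.mul_assoc, mul_nonsing_inv _ hV, Matrix.mul_one]
  · rintro ⟨c, rfl⟩
    exact ⟨V *ᵥ c, by rw [mulVec_mulVec]⟩

lemma smul_matrix_cancel {k : ℤ} (hk : k ≠ 0) {M N : Matrix (Fin 3) (Fin 3) ℤ}
    (h : k • M = k • N) : M = N :=
  smul_right_injective _ hk h

/-- If the rescaled form on the radical lattice is `K`, then the form embeds into `K` with
index `p`. -/
lemma IsRadicalBasis.exists_embedding {K T Y : Matrix (Fin 3) (Fin 3) ℤ}
    (hT : IsModHyperbolic p T) (hY : IsRadicalBasis p T Y)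
    (h : Yᵀ * T * Y = (p : ℤ) ^ 2 • K) :
    ∃ Z : Matrix (Fin 3) (Fin 3) ℤ, Zᵀ * K * Z = T ∧ Z.det.natAbs = p := by
  obtain ⟨Z, hZ, hd⟩ := hY.exists_mul_eq hT
  refine ⟨Z, ?_, hd⟩
  have hp : ((p : ℤ) ^ 2) ≠ 0 := pow_ne_zero _ (by exact_mod_cast (Fact.out : p.Prime).ne_zero)
  apply smul_matrix_cancel hp
  calc (p : ℤ) ^ 2 • (Zᵀ * K * Z) = Zᵀ * ((p : ℤ) ^ 2 • K) * Z := by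
        rw [Matrix.mul_smul, Matrix.smul_mul]
    _ = (Y * Z)ᵀ * T * (Y * Z) := by
        rw [← h, transpose_mul]
        simp only [Matrix.mul_assoc]
    _ = (p : ℤ) ^ 2 • T := by
        rw [hZ, transpose_smul, transpose_one, Matrix.smul_mul, Matrix.one_mul, Matrix.mul_smul,
          Matrix.mul_one, smul_smul, sq]

lemma natAbs_det_of_embedding {q : ℕ} {K T X Z : Matrix (Fin 3) (Fin 3) ℤ} (hK : K.det ≠ 0)
    (hZ : Zᵀ * K * Z = T) (hd : Z.det.natAbs = q) (hX : Xᵀ * K * X = T) :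
    X.det.natAbs = q := by
  have h := congrArg det (hX.trans hZ.symm)
  rw [det_mul, det_mul, det_mul, det_mul, det_transpose, det_transpose] at h
  have h2 : X.det ^ 2 = Z.det ^ 2 := mul_right_cancel₀ hK (by linear_combination h)
  rw [← hd]
  exact Int.natAbs_eq_iff_sq_eq.mpr h2

/-- An embedding of index `p` maps the radical lattice onto `p` times the ambient lattice. -/
lemma IsRadicalBasis.mul_eq_smul_unimodular {K T X Y : Matrix (Fin 3) (Fin 3) ℤ}
    (hT : IsModHyperbolic p T) (hY : IsRadicalBasis p T Y) (hX : Xᵀ * K * X = T)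
    (hd : X.det.natAbs = p) :
    ∃ U : Matrix (Fin 3) (Fin 3) ℤ, IsUnit U.det ∧ X * Y = (p : ℤ) • U := by
  have hp : p.Prime := Fact.out
  have hYd := hY.natAbs_det hT
  obtain ⟨P, hP, h⟩ := hT
  obtain ⟨r, hr, hr'⟩ := exists_radical_of_congr hP h
  have hdet0 : (modMat p X).det = 0 := by
    rw [modMat_det, ZMod.intCast_zmod_eq_zero_iff_dvd, Int.natCast_dvd, hd]
  obtain ⟨u, hu0, hu⟩ : ∃ u : Fin 3 → ZMod p, u ≠ 0 ∧ modMat p X *ᵥ u = 0 :=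
    exists_mulVec_eq_zero_iff.mpr hdet0
  have hTu : modMat p T *ᵥ u = 0 := by
    rw [← hX, map_mul, ← mulVec_mulVec, hu, mulVec_zero]
  obtain ⟨t, rfl⟩ := (hr' u).mp hTu
  have ht : t ≠ 0 := by
    rintro rfl
    simp at hu0
  have hXr : modMat p X *ᵥ r = 0 := by
    rw [mulVec_smul] at hu
    exact (smul_eq_zero.mp hu).resolve_left ht
  have hXY : modMat p (X * Y) = 0 := by
    have : ∀ y : Fin 3 → ZMod p, modMat p (X * Y) *ᵥ y = 0 := by
      intro y
      obtain ⟨c, rfl⟩ := modVec_surjective (p := p) y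
      rw [map_mul, ← mulVec_mulVec, ← modVec_mulVec Y]
      obtain ⟨s, hs⟩ := (hr' _).mp ((hY (Y *ᵥ c)).mpr ⟨c, rfl⟩)
      rw [hs, mulVec_smul, hXr, smul_zero]
    ext i j
    have := congrFun (this (Pi.single j 1)) i
    simpa using this
  obtain ⟨U, hU⟩ := (modMat_eq_zero_iff _).mp hXY
  refine ⟨U, ?_, hU⟩
  have h1 := congrArg (fun M => Int.natAbs (det M)) hU
  simp only [det_mul, det_smul, Int.natAbs_mul, Int.natAbs_pow, hd, hYd, Fintype.card_fin,
      Int.natAbs_natCast] at h1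
  rw [isUnit_int_det_iff]
  exact Nat.eq_of_mul_eq_mul_left (pow_pos hp.pos 3) (by rw [← h1]; ring)

lemma matrix_mul_left_cancel {X M N : Matrix (Fin 3) (Fin 3) ℤ} (hX : X.det ≠ 0)
    (h : X * M = X * N) : M = N := by
  have := congrArg (X.adjugate * ·) h
  simp only [← Matrix.mul_assoc, adjugate_mul, Matrix.smul_mul, Matrix.one_mul] at this
  exact smul_matrix_cancel hX this

lemma matrix_mul_right_cancel {X M N : Matrix (Fin 3) (Fin 3) ℤ} (hX : X.det ≠ 0)
    (h : M * X = N * X) : M = N := by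
  have := congrArg (· * X.adjugate) h
  simp only [Matrix.mul_assoc, mul_adjugate, Matrix.mul_smul, Matrix.mul_one] at this
  exact smul_matrix_cancel hX this

/-- The integral automorphs of `T`. -/
abbrev Automorph (T : Matrix (Fin 3) (Fin 3) ℤ) :=
  {U : Matrix (Fin 3) (Fin 3) ℤ // IsUnit U.det ∧ Uᵀ * T * U = T}

/-- The integral embeddings of `T` into `K`. -/
abbrev IntEmbedding (K T : Matrix (Fin 3) (Fin 3) ℤ) :=
  {X : Matrix (Fin 3) (Fin 3) ℤ // Xᵀ * K * X = T}

lemma card_embedding_eq {K T Z : Matrix (Fin 3) (Fin 3) ℤ} (hK : K.det ≠ 0)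
    (hT : IsModHyperbolic p T) (hZ : Zᵀ * K * Z = T) (hd : Z.det.natAbs = p) :
    Nat.card (IntEmbedding K T) = Nat.card (Automorph K) := by
  have hZ0 : Z.det ≠ 0 := natAbs_det_ne_zero (p := p) (k := 1) (by rwa [pow_one])
  have hp0 : (p : ℤ) ≠ 0 := by exact_mod_cast (Fact.out : p.Prime).ne_zero
  let f : Automorph K → IntEmbedding K T := fun U => ⟨U.1 * Z, by
    rw [transpose_mul, ← hZ]
    conv_rhs => rw [← U.2.2]
    simp only [Matrix.mul_assoc]⟩
  refine (Nat.card_congr (Equiv.ofBijective f ⟨fun U V h => ?_, fun X => ?_⟩)).symm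
  · exact Subtype.ext (matrix_mul_right_cancel hZ0 (congrArg Subtype.val h))
  · obtain ⟨Y, hYd, hY⟩ := hT.exists_isRadicalBasis
    have hY0 : Y.det ≠ 0 := natAbs_det_ne_zero hYd
    obtain ⟨U₀, hU₀, h₀⟩ := hY.mul_eq_smul_unimodular hT hZ hd
    obtain ⟨U, hU, h⟩ := hY.mul_eq_smul_unimodular hT X.2 (natAbs_det_of_embedding hK hZ hd X.2)
    have hUZ : U * U₀⁻¹ * Z = X.1 := by
      apply matrix_mul_right_cancel hY0
      rw [Matrix.mul_assoc, h₀, h, Matrix.mul_smul, Matrix.mul_assoc, nonsing_inv_mul _ hU₀,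
        Matrix.mul_one]
    refine ⟨⟨U * U₀⁻¹, ?_, ?_⟩, Subtype.ext hUZ⟩
    · rw [det_mul]
      exact hU.mul (isUnit_nonsing_inv_det _ hU₀)
    · apply matrix_mul_right_cancel hZ0
      apply matrix_mul_left_cancel (X := Zᵀ) (by rwa [det_transpose])
      have := X.2
      rw [← hUZ, transpose_mul] at this
      simp only [Matrix.mul_assoc] at this hZ ⊢
      rw [this, hZ]

end Embeddings

section Counting

variable {p : ℕ} [Fact p.Prime]

lemma congr_mul {R : Type*} [CommRing R] {K T T' X W : Matrix (Fin 3) (Fin 3) R}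
    (hX : Xᵀ * K * X = T) (hW : Wᵀ * T * W = T') : (X * W)ᵀ * K * (X * W) = T' := by
  rw [← hW, ← hX, transpose_mul]
  simp only [Matrix.mul_assoc]

lemma exists_smul_of_hyperplane_le {F : Type*} [Field F] {ℓ ℓ' : Fin 3 → F} (hℓ : ℓ ≠ 0)
    (h : ∀ y : Fin 3 → F, ℓ ⬝ᵥ y = 0 → ℓ' ⬝ᵥ y = 0) : ∃ t : F, ℓ' = t • ℓ := by
  obtain ⟨i, hi⟩ := Function.ne_iff.mp hℓ
  rw [Pi.zero_apply] at hi
  refine ⟨ℓ' i / ℓ i, ?_⟩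
  ext j
  have h1 := h (ℓ i • Pi.single j 1 - ℓ j • Pi.single i 1) (by
    simp [dotProduct_sub, mul_comm])
  simp only [dotProduct_sub, dotProduct_smul, dotProduct_single, mul_one, smul_eq_mul] at h1
  rw [Pi.smul_apply, smul_eq_mul]
  field_simp
  linear_combination h1

/-- The image of a matrix of index `p` is the hyperplane lattice of any nonzero vector that
annihilates its reduction. -/
lemma image_iff_of_vecMul_eq_zero {X : Matrix (Fin 3) (Fin 3) ℤ} (hd : X.det.natAbs = p)
    {ℓ : Fin 3 → ZMod p} (hℓ : ℓ ≠ 0) (h : ℓ ᵥ* modMat p X = 0) (x : Fin 3 → ℤ) :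
    ℓ ⬝ᵥ modVec p x = 0 ↔ ∃ c, x = X *ᵥ c := by
  have hmem : ∀ c, ℓ ⬝ᵥ modVec p (X *ᵥ c) = 0 := fun c => by
    rw [modVec_mulVec, dotProduct_mulVec, h, zero_dotProduct]
  obtain ⟨B, hB, hB', -⟩ := exists_lattice_of_hyperplane hℓ
  obtain ⟨W, rfl⟩ := exists_eq_mul_of_columns fun c => (hB' _).mp (hmem c)
  have hW : IsUnit W.det := by
    rw [det_mul, Int.natAbs_mul, hB] at hd
    rw [isUnit_int_det_iff]
    exact Nat.eq_of_mul_eq_mul_left (Fact.out : p.Prime).pos (by rw [hd, mul_one])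
  refine ⟨fun hx => ?_, ?_⟩
  · obtain ⟨c, rfl⟩ := (hB' x).mp hx
    exact ⟨W⁻¹ *ᵥ c, by rw [mulVec_mulVec, Matrix.mul_assoc, mul_nonsing_inv _ hW, Matrix.mul_one]⟩
  · rintro ⟨c, rfl⟩
    exact hmem c

lemma exists_vecMul_eq_zero_iff_smul {X : Matrix (Fin 3) (Fin 3) ℤ} (hd : X.det.natAbs = p) :
    ∃ ℓ₀ : Fin 3 → ZMod p, ℓ₀ ≠ 0 ∧ ∀ ℓ, ℓ ᵥ* modMat p X = 0 ↔ ∃ t : ZMod p, ℓ = t • ℓ₀ := by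
  have hdet0 : (modMat p X).det = 0 := by
    rw [modMat_det, ZMod.intCast_zmod_eq_zero_iff_dvd, Int.natCast_dvd, hd]
  obtain ⟨ℓ₀, h0, hℓ₀⟩ := exists_vecMul_eq_zero_iff.mpr hdet0
  refine ⟨ℓ₀, h0, fun ℓ => ⟨fun h => ?_, ?_⟩⟩
  · refine exists_smul_of_hyperplane_le h0 fun y hy => ?_
    obtain ⟨x, rfl⟩ := modVec_surjective (p := p) y
    obtain ⟨c, rfl⟩ := (image_iff_of_vecMul_eq_zero hd h0 hℓ₀ x).mp hy
    rw [modVec_mulVec, dotProduct_mulVec, h, zero_dotProduct]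
  · rintro ⟨t, rfl⟩
    rw [smul_vecMul, hℓ₀, smul_zero]

lemma card_eq_mul_of_fiber {α β γ : Type*} (f : α → β)
    (h : ∀ b, Nonempty ({a // f a = b} ≃ γ)) : Nat.card α = Nat.card β * Nat.card γ := by
  rw [← Nat.card_prod]
  exact Nat.card_congr ((Equiv.sigmaFiberEquiv f).symm.trans
    ((Equiv.sigmaCongrRight fun b => (h b).some).trans (Equiv.sigmaEquivProd β γ)))

/-- The nonzero vectors modulo `p` whose hyperplane lattice in `K` is isometric to `T`. -/
def IsNeighborVec (K T : Matrix (Fin 3) (Fin 3) ℤ) (ℓ : Fin 3 → ZMod p) : Prop :=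
  ℓ ≠ 0 ∧ ∃ X : Matrix (Fin 3) (Fin 3) ℤ, Xᵀ * K * X = T ∧ ℓ ᵥ* modMat p X = 0

lemma exists_congr_of_vecMul {K T T' Z X : Matrix (Fin 3) (Fin 3) ℤ}
    (hZ : Zᵀ * K * Z = T) (hdZ : Z.det.natAbs = p) (hX : Xᵀ * K * X = T')
    (hdX : X.det.natAbs = p) {ℓ : Fin 3 → ZMod p} (hℓ : ℓ ≠ 0) (hZℓ : ℓ ᵥ* modMat p Z = 0)
    (hXℓ : ℓ ᵥ* modMat p X = 0) : ∃ W, IsUnit W.det ∧ Wᵀ * T * W = T' ∧ X = Z * W := by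
  obtain ⟨W, hW, rfl⟩ := exists_unimodular_of_same_image
    (natAbs_det_ne_zero (p := p) (k := 1) (by rwa [pow_one]))
    fun x => (image_iff_of_vecMul_eq_zero hdX hℓ hXℓ x).symm.trans
      (image_iff_of_vecMul_eq_zero hdZ hℓ hZℓ x)
  refine ⟨W, hW, ?_, rfl⟩
  exact (congr_mul hZ rfl).symm.trans hX

lemma card_embedding_mul {K T Z : Matrix (Fin 3) (Fin 3) ℤ} (hK : K.det ≠ 0)
    (hZ : Zᵀ * K * Z = T) (hd : Z.det.natAbs = p) :
    Nat.card (IntEmbedding K T) * (p - 1)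
      = Nat.card {ℓ : Fin 3 → ZMod p // IsNeighborVec K T ℓ} * Nat.card (Automorph T) := by
  let S := {q : IntEmbedding K T × (Fin 3 → ZMod p) // q.2 ≠ 0 ∧ q.2 ᵥ* modMat p q.1.1 = 0}
  have hdX : ∀ X : IntEmbedding K T, X.1.det.natAbs = p := fun X =>
    natAbs_det_of_embedding hK hZ hd X.2
  have h1 : Nat.card S = Nat.card (IntEmbedding K T) * Nat.card (ZMod p)ˣ := by
    refine card_eq_mul_of_fiber (fun s : S => s.1.1) fun X => ?_
    obtain ⟨ℓ₀, h0, hℓ₀⟩ := exists_vecMul_eq_zero_iff_smul (hdX X)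
    refine ⟨(Equiv.ofBijective (fun t : (ZMod p)ˣ => ⟨⟨⟨X, (t : ZMod p) • ℓ₀⟩,
      smul_ne_zero t.ne_zero h0, (hℓ₀ _).mpr ⟨t, rfl⟩⟩, rfl⟩) ⟨fun s t h => ?_, ?_⟩).symm⟩
    · have := congrArg (fun a => a.1.1.2) h
      exact Units.ext (smul_left_injective _ h0 this)
    · rintro ⟨⟨⟨X', ℓ⟩, hℓ, hℓX⟩, rfl⟩
      obtain ⟨t, rfl⟩ := (hℓ₀ ℓ).mp hℓX
      exact ⟨Units.mk0 t fun h => hℓ (by simp [h]), rfl⟩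
  have h2 : Nat.card S
      = Nat.card {ℓ : Fin 3 → ZMod p // IsNeighborVec K T ℓ} * Nat.card (Automorph T) := by
    refine card_eq_mul_of_fiber
      (fun s : S => ⟨s.1.2, s.2.1, s.1.1.1, s.1.1.2, s.2.2⟩) fun ℓ => ?_
    obtain ⟨ℓ, hℓ, X₀, hX₀, hℓX₀⟩ := ℓ
    have hd₀ := hdX ⟨X₀, hX₀⟩
    have hmul : ∀ W : Automorph T, (X₀ * W.1)ᵀ * K * (X₀ * W.1) = T := fun W =>
      congr_mul hX₀ W.2.2
    have hvec : ∀ W : Automorph T, ℓ ᵥ* modMat p (X₀ * W.1) = 0 := fun W => by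
      rw [map_mul, ← vecMul_vecMul, hℓX₀, zero_vecMul]
    refine ⟨(Equiv.ofBijective (fun W : Automorph T =>
      ⟨⟨⟨⟨X₀ * W.1, hmul W⟩, ℓ⟩, hℓ, hvec W⟩, rfl⟩) ⟨fun s t h => ?_, ?_⟩).symm⟩
    · have := congrArg (fun a => a.1.1.1.1) h
      exact Subtype.ext (matrix_mul_left_cancel
        (natAbs_det_ne_zero (p := p) (k := 1) (by rwa [pow_one])) this)
    · rintro ⟨⟨⟨X', ℓ'⟩, hℓ', hℓX'⟩, h⟩
      obtain rfl : ℓ' = ℓ := congrArg Subtype.val h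
      obtain ⟨W, hW, hWT, hXW⟩ := exists_congr_of_vecMul hX₀ hd₀ X'.2 (hdX X') hℓ hℓX₀ hℓX'
      refine ⟨⟨W, hW, hWT⟩, ?_⟩
      apply Subtype.ext
      apply Subtype.ext
      exact Prod.ext (Subtype.ext hXW.symm) rfl
  rw [← h2, h1, Nat.card_eq_fintype_card (α := (ZMod p)ˣ), ZMod.card_units_eq_totient,
    Nat.totient_prime Fact.out]

lemma card_solutions_of_isNeighborVec {K T Z : Matrix (Fin 3) (Fin 3) ℤ} (hK : K.det ≠ 0)
    (hZ : Zᵀ * K * Z = T) (hd : Z.det.natAbs = p) {ℓ : Fin 3 → ZMod p}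
    (hℓ : IsNeighborVec K T ℓ) (k : ℤ) :
    Nat.card {x : Fin 3 → ℤ // x ⬝ᵥ T *ᵥ x = k}
      = Nat.card {v : Fin 3 → ℤ // v ⬝ᵥ K *ᵥ v = k ∧ ℓ ⬝ᵥ modVec p v = 0} := by
  obtain ⟨h0, X, hX, hXℓ⟩ := hℓ
  have hdX := natAbs_det_of_embedding hK hZ hd hX
  have himg := image_iff_of_vecMul_eq_zero hdX h0 hXℓ
  have hX0 : X.det ≠ 0 := natAbs_det_ne_zero (p := p) (k := 1) (by rwa [pow_one])
  refine Nat.card_congr (Equiv.ofBijective (fun x => ⟨X *ᵥ x.1, ?_, ?_⟩) ⟨fun x y h => ?_, ?_⟩)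
  · rw [← dotProduct_mulVec_congr, hX, x.2]
  · exact (himg _).mpr ⟨_, rfl⟩
  · exact Subtype.ext (mulVec_injective_of_det_ne_zero hX0 (congrArg Subtype.val h))
  · rintro ⟨v, hv, hvℓ⟩
    obtain ⟨c, rfl⟩ := (himg v).mp hvℓ
    exact ⟨⟨c, by rw [← hX, dotProduct_mulVec_congr, hv]⟩, rfl⟩

end Counting

section Genus

variable {p : ℕ} [Fact p.Prime]

/-- The form `T` is `ℤ_p`-equivalent to a hyperbolic plane plus `[c]`. -/
def IsLocHyperbolic (p : ℕ) [Fact p.Prime] (c : ℤ_[p]) (T : Matrix (Fin 3) (Fin 3) ℤ) : Prop :=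
  ∃ X : Matrix (Fin 3) (Fin 3) ℤ_[p], IsUnit X.det ∧ Xᵀ * padMat p T * X = hyperbolicSum c

/-- The vectors modulo `p` whose hyperplane in the reduction of `K` is, modulo its radical,
a hyperbolic plane. -/
def IsHyperbolicVec (K : Matrix (Fin 3) (Fin 3) ℤ) (ℓ : Fin 3 → ZMod p) : Prop :=
  quadraticChar (ZMod p) (-(ℓ ⬝ᵥ (modMat p K).adjugate *ᵥ ℓ)) = 1

lemma IsHyperbolicVec.ne_zero {K : Matrix (Fin 3) (Fin 3) ℤ} {ℓ : Fin 3 → ZMod p}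
    (h : IsHyperbolicVec K ℓ) : ℓ ≠ 0 := by
  rintro rfl
  simp [IsHyperbolicVec] at h

lemma IsLocHyperbolic.isModHyperbolic {c : ℤ_[p]} {T : Matrix (Fin 3) (Fin 3) ℤ}
    (h : IsLocHyperbolic p c T) (hc : PadicInt.toZMod c = 0) : IsModHyperbolic p T := by
  obtain ⟨X, hX, hXT⟩ := h
  exact modMat_congr_of_padMat_congr hX hXT hc

lemma IsLocHyperbolic.exists_det_eq {c : ℤ_[p]} {T : Matrix (Fin 3) (Fin 3) ℤ}
    (h : IsLocHyperbolic p c T) : ∃ w : ℤ_[p], IsUnit w ∧ (T.det : ℤ_[p]) = -(w ^ 2 * c) := by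
  obtain ⟨X, hX, hXT⟩ := h
  obtain ⟨w, hw⟩ := hX.exists_left_inv
  refine ⟨w, IsUnit.of_mul_eq_one _ hw, ?_⟩
  have h1 := congrArg det hXT
  rw [det_mul, det_mul, det_transpose, padMat_det, det_hyperbolicSum] at h1
  linear_combination w ^ 2 * h1 - (T.det : ℤ_[p]) * (w * X.det + 1) * hw

lemma isUnit_padMat_det {q : ℕ} [Fact q.Prime] (hqp : q ≠ p) {B : Matrix (Fin 3) (Fin 3) ℤ}
    (hB : B.det.natAbs = p) : IsUnit (padMat q B).det := by
  rw [padMat_det, padicInt_isUnit_iff_toZMod_ne_zero, map_intCast, Ne,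
    ZMod.intCast_zmod_eq_zero_iff_dvd, Int.natCast_dvd, hB]
  exact fun h => hqp ((Nat.prime_dvd_prime_iff_eq Fact.out Fact.out).mp h)

lemma exists_padic_congr_of_embeddings {q : ℕ} [Fact q.Prime] (hqp : q ≠ p)
    {K B Z : Matrix (Fin 3) (Fin 3) ℤ} (hB : B.det.natAbs = p) (hZ : Z.det.natAbs = p) :
    ∃ X : Matrix (Fin 3) (Fin 3) ℤ_[q], IsUnit X.det ∧
      Xᵀ * padMat q (Bᵀ * K * B) * X = padMat q (Zᵀ * K * Z) := by
  have hBu := isUnit_padMat_det hqp hB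
  refine ⟨(padMat q B)⁻¹ * padMat q Z, ?_, ?_⟩
  · rw [det_mul]
    exact (isUnit_nonsing_inv_det _ hBu).mul (isUnit_padMat_det hqp hZ)
  · have h := congr_mul (K := padMat q K) (X := padMat q B)
      (W := (padMat q B)⁻¹ * padMat q Z) rfl rfl
    rw [← Matrix.mul_assoc (padMat q B), mul_nonsing_inv _ hBu, Matrix.one_mul] at h
    rw [map_mul, map_mul, map_mul, map_mul, padMat_transpose, padMat_transpose]
    exact h.symm

lemma IsLocHyperbolic.exists_padic_congr {c : ℤ_[p]} {T T' : Matrix (Fin 3) (Fin 3) ℤ}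
    (h : IsLocHyperbolic p c T) (h' : IsLocHyperbolic p c T') :
    ∃ X : Matrix (Fin 3) (Fin 3) ℤ_[p], IsUnit X.det ∧ Xᵀ * padMat p T * X = padMat p T' := by
  obtain ⟨X, hX, hXT⟩ := h
  obtain ⟨X', hX', hXT'⟩ := h'
  refine ⟨X * X'⁻¹, ?_, congr_mul hXT ?_⟩
  · rw [det_mul]
    exact hX.mul (isUnit_nonsing_inv_det _ hX')
  · rw [← hXT', ← congr_mul rfl rfl, mul_nonsing_inv _ hX']
    simp

lemma IsLocHyperbolic.of_padic_congr {c : ℤ_[p]} {T T' : Matrix (Fin 3) (Fin 3) ℤ}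
    (h : IsLocHyperbolic p c T') {X : Matrix (Fin 3) (Fin 3) ℤ_[p]} (hX : IsUnit X.det)
    (hXT : Xᵀ * padMat p T * X = padMat p T') : IsLocHyperbolic p c T := by
  obtain ⟨X', hX', hXT'⟩ := h
  exact ⟨X * X', by rw [det_mul]; exact hX.mul hX', congr_mul hXT hXT'⟩

lemma exists_adjugate_eq_vecMulVec {X : Matrix (Fin 3) (Fin 3) ℤ} (hd : X.det.natAbs = p)
    {ℓ : Fin 3 → ZMod p} (hℓ : ℓ ≠ 0) (h : ℓ ᵥ* modMat p X = 0) :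
    ∃ u : Fin 3 → ZMod p, (modMat p X).adjugate = vecMulVec u ℓ := by
  obtain ⟨ℓ₀, h0, hℓ₀⟩ := exists_vecMul_eq_zero_iff_smul hd
  obtain ⟨t, rfl⟩ := (hℓ₀ ℓ).mp h
  have ht : t ≠ 0 := by
    rintro rfl
    simp at hℓ
  have hdet0 : (modMat p X).det = 0 := by
    rw [modMat_det, ZMod.intCast_zmod_eq_zero_iff_dvd, Int.natCast_dvd, hd]
  have hrow : ∀ i, ∃ s : ZMod p, (modMat p X).adjugate i = s • ℓ₀ := fun i => by
    refine (hℓ₀ _).mp ?_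
    have := congrFun (adjugate_mul (modMat p X)) i
    rw [hdet0, zero_smul] at this
    exact this
  choose s hs using hrow
  refine ⟨fun i => s i / t, ?_⟩
  ext i j
  rw [hs, vecMulVec_apply, Pi.smul_apply, Pi.smul_apply, smul_eq_mul, smul_eq_mul]
  field_simp

lemma adjugate_congr_of_eq_vecMulVec {F : Type*} [Field F] {K X : Matrix (Fin 3) (Fin 3) F}
    {u ℓ : Fin 3 → F} (h : X.adjugate = vecMulVec u ℓ) (i j : Fin 3) :
    (Xᵀ * K * X).adjugate i j = u i * u j * (ℓ ⬝ᵥ K.adjugate *ᵥ ℓ) := by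
  rw [adjugate_mul_distrib, adjugate_mul_distrib, ← adjugate_transpose, h, transpose_vecMulVec]
  simp only [Matrix.mul_apply, vecMulVec_apply, dotProduct, mulVec, Fin.sum_univ_three]
  ring

lemma IsNeighborVec.isHyperbolicVec {K T Z : Matrix (Fin 3) (Fin 3) ℤ} (hK : K.det ≠ 0)
    (hT : IsModHyperbolic p T) (hZ : Zᵀ * K * Z = T) (hd : Z.det.natAbs = p)
    {ℓ : Fin 3 → ZMod p} (h : IsNeighborVec K T ℓ) : IsHyperbolicVec K ℓ := by
  obtain ⟨hℓ, X, hX, hXℓ⟩ := h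
  have hdX := natAbs_det_of_embedding hK hZ hd hX
  obtain ⟨u, hu⟩ := exists_adjugate_eq_vecMulVec hdX hℓ hXℓ
  obtain ⟨P, hP, hPT⟩ := hT
  obtain ⟨w, hw, hwT⟩ := exists_adjugate_eq_of_congr hP hPT
  obtain ⟨i, hi⟩ := Function.ne_iff.mp hw
  rw [Pi.zero_apply] at hi
  have h1 := adjugate_congr_of_eq_vecMulVec (K := modMat p K) hu i i
  rw [← modMat_transpose, ← map_mul, ← map_mul, hX, hwT, Matrix.neg_apply, vecMulVec_apply] at h1
  have hui : u i ≠ 0 := by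
    intro h0
    rw [h0] at h1
    simp [hi] at h1
  have h2 : -(ℓ ⬝ᵥ (modMat p K).adjugate *ᵥ ℓ) = (w i / u i) ^ 2 := by
    field_simp
    linear_combination h1
  rw [IsHyperbolicVec, h2]
  exact quadraticChar_sq_one' (div_ne_zero hi hui)

lemma IsHyperbolicVec.exists_sublattice {K T Z : Matrix (Fin 3) (Fin 3) ℤ} (hp : p ≠ 2)
    (hKs : K.IsSymm) {c : ℤ_[p]} (hT : IsLocHyperbolic p c T) (hZ : Zᵀ * K * Z = T)
    (hd : Z.det.natAbs = p) {ℓ : Fin 3 → ZMod p} (h : IsHyperbolicVec K ℓ) :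
    ∃ B : Matrix (Fin 3) (Fin 3) ℤ, B.det.natAbs = p ∧ ℓ ᵥ* modMat p B = 0 ∧
      IsLocHyperbolic p c (Bᵀ * K * B) := by
  have hℓ := h.ne_zero
  obtain ⟨B, hB, hBℓ, t, ht, hadj⟩ := exists_lattice_of_hyperplane hℓ
  refine ⟨B, hB, ?_, ?_⟩
  · ext i
    have := (hBℓ (B *ᵥ Pi.single i 1)).mpr ⟨_, rfl⟩
    rw [modVec_mulVec, dotProduct_mulVec] at this
    have hs : modVec p (Pi.single i 1) = Pi.single i 1 := by
      ext j
      by_cases hij : j = i <;> simp [modVec, hij]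
    rwa [hs, dotProduct_single, mul_one] at this
  · have hne : -(ℓ ⬝ᵥ (modMat p K).adjugate *ᵥ ℓ) ≠ 0 := by
      intro h0
      rw [IsHyperbolicVec, h0] at h
      simp at h
    obtain ⟨s, hs⟩ := (quadraticChar_one_iff_isSquare hne).mp h
    have hs0 : s ≠ 0 := by
      rintro rfl
      simp at hs
      exact hne (by rw [hs, neg_zero])
    obtain ⟨w, hw, hwT⟩ := hT.exists_det_eq
    have hdet : (Bᵀ * K * B).det = T.det := by
      rw [← hZ, det_mul, det_mul, det_mul, det_mul, det_transpose, det_transpose]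
      have := Int.natAbs_eq_iff_sq_eq.mp (hB.trans hd.symm)
      linear_combination K.det * this
    refine padicInt_congr_hyperbolicSum hp (T := padMat p (Bᵀ * K * B)) ?_
      (mul_ne_zero ht hs0) ?_ hw (by rw [padMat_det, hdet, hwT])
    · have := isSymm_congr hKs B
      rw [IsSymm, ← padMat_transpose, this.eq]
    · have h1 : PadicInt.toZMod ((padMat p (Bᵀ * K * B)).adjugate 2 2)
          = (modMat p (Bᵀ * K * B)).adjugate 2 2 := by
        have : (padMat p (Bᵀ * K * B)).adjugate = padMat p (Bᵀ * K * B).adjugate :=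
          (RingHom.map_adjugate (Int.castRingHom ℤ_[p]) _).symm
        rw [this, padMat_apply, map_intCast, ← modMat_adjugate, modMat_apply]
      have h2 : (modMat p B).adjugate = vecMulVec (t • Pi.single 2 1) ℓ := by
        rw [hadj, vecMulVec_smul, smul_vecMulVec]
      rw [h1, map_mul, map_mul, modMat_transpose, adjugate_congr_of_eq_vecMulVec h2]
      simp only [Pi.smul_apply, Pi.single_eq_same, smul_eq_mul, mul_one]
      linear_combination -t ^ 2 * hs

end Genus

section Mass

variable {p : ℕ} [Fact p.Prime]

open Classical in
/-- The mass-weighted representation numbers of the index-`p` sublattices of `K` are counted by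
hyperplanes. -/
lemma sum_div_card_automorph (hp : p ≠ 2) {K TL ZL : Matrix (Fin 3) (Fin 3) ℤ} (hKs : K.IsSymm)
    (hK : K.det ≠ 0) (hoK : Nat.card (Automorph K) ≠ 0) {c : ℤ_[p]} (hc : PadicInt.toZMod c = 0)
    (hTL : IsLocHyperbolic p c TL) (hZL : ZLᵀ * K * ZL = TL) (hdL : ZL.det.natAbs = p)
    {g : ℕ} {T Z : Fin g → Matrix (Fin 3) (Fin 3) ℤ} (hT : ∀ i, IsLocHyperbolic p c (T i))
    (hZ : ∀ i, (Z i)ᵀ * K * Z i = T i) (hd : ∀ i, (Z i).det.natAbs = p)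
    (hne : ∀ i j W, IsUnit W.det → Wᵀ * T i * W = T j → i = j)
    (hcomp : ∀ B : Matrix (Fin 3) (Fin 3) ℤ, B.det.natAbs = p →
      IsLocHyperbolic p c (Bᵀ * K * B) → ∃ i W, IsUnit W.det ∧ Wᵀ * (Bᵀ * K * B) * W = T i)
    (k : ℤ) :
    (∑ i, (Nat.card {x : Fin 3 → ℤ // x ⬝ᵥ T i *ᵥ x = k} : ℚ) / Nat.card (Automorph (T i)))
        * (Nat.card (Automorph K) * (p - 1))
      = ∑ ℓ : Fin 3 → ZMod p with IsHyperbolicVec K ℓ,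
        (Nat.card {v : Fin 3 → ℤ // v ⬝ᵥ K *ᵥ v = k ∧ ℓ ⬝ᵥ modVec p v = 0} : ℚ) := by
  have hp1 : 1 < p := (Fact.out : p.Prime).one_lt
  have hunion : Finset.univ.filter (fun ℓ : Fin 3 → ZMod p => IsHyperbolicVec K ℓ)
      = Finset.univ.biUnion fun i => Finset.univ.filter fun ℓ => IsNeighborVec K (T i) ℓ := by
    ext ℓ
    simp only [Finset.mem_filter, Finset.mem_univ, true_and, Finset.mem_biUnion]
    constructor
    · intro h
      obtain ⟨B, hB, hℓB, hBT⟩ := h.exists_sublattice hp hKs hTL hZL hdL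
      obtain ⟨i, W, hW, hWT⟩ := hcomp B hB hBT
      exact ⟨i, h.ne_zero, B * W, congr_mul rfl hWT, by
        rw [map_mul, ← vecMul_vecMul, hℓB, zero_vecMul]⟩
    · rintro ⟨i, h⟩
      exact h.isHyperbolicVec hK ((hT i).isModHyperbolic hc) (hZ i) (hd i)
  have hdisj : ((Finset.univ : Finset (Fin g)) : Set (Fin g)).PairwiseDisjoint
      fun i => Finset.univ.filter fun ℓ : Fin 3 → ZMod p => IsNeighborVec K (T i) ℓ := by
    intro i _ j _ hij
    refine Finset.disjoint_left.mpr fun ℓ hi hj => hij ?_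
    obtain ⟨h0, X, hX, hXℓ⟩ := (Finset.mem_filter.mp hi).2
    obtain ⟨-, X', hX', hXℓ'⟩ := (Finset.mem_filter.mp hj).2
    obtain ⟨W, hW, hWT, -⟩ := exists_congr_of_vecMul hX
      (natAbs_det_of_embedding hK (hZ i) (hd i) hX) hX'
      (natAbs_det_of_embedding hK (hZ j) (hd j) hX') h0 hXℓ hXℓ'
    exact hne i j W hW hWT
  rw [hunion, Finset.sum_biUnion hdisj, Finset.sum_mul]
  refine Finset.sum_congr rfl fun i _ => ?_
  have hcard := card_embedding_mul hK (hZ i) (hd i)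
  rw [card_embedding_eq hK ((hT i).isModHyperbolic hc) (hZ i) (hd i)] at hcard
  have ho : Nat.card (Automorph (T i)) ≠ 0 := by
    intro h0
    rw [h0, mul_zero] at hcard
    exact mul_ne_zero hoK (by omega) hcard
  have hcard' : (Nat.card (Automorph K) : ℚ) * (p - 1)
      = Nat.card {ℓ : Fin 3 → ZMod p // IsNeighborVec K (T i) ℓ} * Nat.card (Automorph (T i)) := by
    rw [← Nat.cast_mul, ← hcard, Nat.cast_mul, Nat.cast_sub hp1.le, Nat.cast_one]
  have hconst : ∀ ℓ ∈ Finset.univ.filter (fun ℓ : Fin 3 → ZMod p => IsNeighborVec K (T i) ℓ),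
      (Nat.card {v : Fin 3 → ℤ // v ⬝ᵥ K *ᵥ v = k ∧ ℓ ⬝ᵥ modVec p v = 0} : ℚ)
        = Nat.card {x : Fin 3 → ℤ // x ⬝ᵥ T i *ᵥ x = k} := fun ℓ hℓ => by
    rw [card_solutions_of_isNeighborVec hK (hZ i) (hd i) (Finset.mem_filter.mp hℓ).2]
  rw [Finset.sum_congr rfl hconst, Finset.sum_const, nsmul_eq_mul, hcard',
    Nat.card_eq_fintype_card (α := {ℓ : Fin 3 → ZMod p // IsNeighborVec K (T i) ℓ}),
    Fintype.card_subtype]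
  field_simp

open Classical in
lemma sum_card_solutions_swap {K : Matrix (Fin 3) (Fin 3) ℤ} {k : ℤ}
    [Finite {v : Fin 3 → ℤ // v ⬝ᵥ K *ᵥ v = k}] {N : ℚ}
    (hN : ∀ v : Fin 3 → ℤ, v ⬝ᵥ K *ᵥ v = k →
      ((Finset.univ.filter fun ℓ : Fin 3 → ZMod p =>
        ℓ ⬝ᵥ modVec p v = 0 ∧ IsHyperbolicVec K ℓ).card : ℚ) = N) :
    ∑ ℓ : Fin 3 → ZMod p with IsHyperbolicVec K ℓ,
        (Nat.card {v : Fin 3 → ℤ // v ⬝ᵥ K *ᵥ v = k ∧ ℓ ⬝ᵥ modVec p v = 0} : ℚ)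
      = Nat.card {v : Fin 3 → ℤ // v ⬝ᵥ K *ᵥ v = k} * N := by
  have := Fintype.ofFinite {v : Fin 3 → ℤ // v ⬝ᵥ K *ᵥ v = k}
  have h1 : ∀ ℓ : Fin 3 → ZMod p,
      (Nat.card {v : Fin 3 → ℤ // v ⬝ᵥ K *ᵥ v = k ∧ ℓ ⬝ᵥ modVec p v = 0} : ℚ)
        = ∑ v : {v : Fin 3 → ℤ // v ⬝ᵥ K *ᵥ v = k}, if ℓ ⬝ᵥ modVec p v.1 = 0 then 1 else 0 := by
    intro ℓ
    rw [Finset.sum_boole, ← Fintype.card_subtype, ← Nat.card_eq_fintype_card]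
    congr 1
    exact Nat.card_congr (Equiv.subtypeSubtypeEquivSubtypeInter
      (fun v : Fin 3 → ℤ => v ⬝ᵥ K *ᵥ v = k) fun v => ℓ ⬝ᵥ modVec p v = 0).symm
  simp only [h1]
  rw [Finset.sum_comm]
  have h2 : ∀ v : {v : Fin 3 → ℤ // v ⬝ᵥ K *ᵥ v = k},
      (∑ ℓ : Fin 3 → ZMod p with IsHyperbolicVec K ℓ,
        if ℓ ⬝ᵥ modVec p v.1 = 0 then (1 : ℚ) else 0) = N := by
    intro v
    rw [Finset.sum_boole, Finset.filter_filter, ← hN v.1 v.2]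
    congr 2
    ext ℓ
    simp [and_comm]
  rw [Finset.sum_congr rfl fun v _ => h2 v, Finset.sum_const, nsmul_eq_mul, Finset.card_univ,
    Nat.card_eq_fintype_card]

open Classical in
lemma card_isHyperbolicVec_of_det_ne_zero (hp : p ≠ 2) {K : Matrix (Fin 3) (Fin 3) ℤ}
    (hKs : K.IsSymm) {n d : ℤ} (hn : ¬ (p : ℤ) ∣ n) (hKd : K.det = 2 * d)
    (hdet : (modMat p K).det ≠ 0) {v : Fin 3 → ℤ} (hv : v ⬝ᵥ K *ᵥ v = 2 * n) :
    ((Finset.univ.filter fun ℓ : Fin 3 → ZMod p =>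
        ℓ ⬝ᵥ modVec p v = 0 ∧ IsHyperbolicVec K ℓ).card : ℚ)
      = ((p : ℚ) - 1) * ((p - legendreSym p (-(n * d))) / 2) := by
  have hF : ringChar (ZMod p) ≠ 2 := by rwa [ZMod.ringChar_zmod_n]
  have hval : modVec p v ⬝ᵥ modMat p K *ᵥ modVec p v = 2 * (n : ZMod p) := by
    rw [← modVec_mulVec]
    have := congrArg (fun a : ℤ => (a : ZMod p)) hv
    simpa [modVec, dotProduct] using this
  have hne : modVec p v ⬝ᵥ modMat p K *ᵥ modVec p v ≠ 0 := by
    rw [hval]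
    exact mul_ne_zero (zmod_two_ne_zero hp)
      (by rwa [Ne, ZMod.intCast_zmod_eq_zero_iff_dvd])
  have hs : (modMat p K).IsSymm := by rw [IsSymm, ← modMat_transpose, hKs.eq]
  have h := card_good_of_det_ne_zero hF hs hne hdet
  have hχ : quadraticChar (ZMod p)
      (-((modVec p v ⬝ᵥ modMat p K *ᵥ modVec p v) * (modMat p K).det))
      = legendreSym p (-(n * d)) := by
    rw [legendreSym, hval, modMat_det, hKd,
      ← quadraticChar_sq_mul (zmod_two_ne_zero hp) (((-(n * d) : ℤ)) : ZMod p)]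
    congr 1
    push_cast
    ring
  rw [hχ, ZMod.card] at h
  have h' := congrArg (fun a : ℤ => (a : ℚ)) h
  push_cast at h'
  have e : (Finset.univ.filter fun ℓ : Fin 3 → ZMod p =>
        ℓ ⬝ᵥ modVec p v = 0 ∧ IsHyperbolicVec K ℓ).card
      = (Finset.univ.filter fun ℓ : Fin 3 → ZMod p => ℓ ⬝ᵥ modVec p v = 0 ∧
        quadraticChar (ZMod p) (-(ℓ ⬝ᵥ (modMat p K).adjugate *ᵥ ℓ)) = 1).card := by
    congr 1
    ext ℓ
    simp [IsHyperbolicVec]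
  rw [e]
  linarith

open Classical in
lemma card_isHyperbolicVec_of_det_eq_zero (hp : p ≠ 2) {K : Matrix (Fin 3) (Fin 3) ℤ}
    (hKs : K.IsSymm) {n : ℤ} (hn : ¬ (p : ℤ) ∣ n) (hdet : (modMat p K).det = 0)
    {ℓ₀ : Fin 3 → ZMod p} (hℓ₀ : IsHyperbolicVec K ℓ₀)
    {v : Fin 3 → ℤ} (hv : v ⬝ᵥ K *ᵥ v = 2 * n) :
    ((Finset.univ.filter fun ℓ : Fin 3 → ZMod p =>
        ℓ ⬝ᵥ modVec p v = 0 ∧ IsHyperbolicVec K ℓ).card : ℚ) = ((p : ℚ) - 1) * p := by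
  have hval : modVec p v ⬝ᵥ modMat p K *ᵥ modVec p v = 2 * (n : ZMod p) := by
    rw [← modVec_mulVec]
    have := congrArg (fun a : ℤ => (a : ZMod p)) hv
    simpa [modVec, dotProduct] using this
  have hne : modVec p v ⬝ᵥ modMat p K *ᵥ modVec p v ≠ 0 := by
    rw [hval]
    exact mul_ne_zero (zmod_two_ne_zero hp)
      (by rwa [Ne, ZMod.intCast_zmod_eq_zero_iff_dvd])
  have hs : (modMat p K).IsSymm := by rw [IsSymm, ← modMat_transpose, hKs.eq]
  have h := card_good_of_det_eq_zero hs hne hdet ⟨ℓ₀, hℓ₀⟩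
  rw [ZMod.card] at h
  have h' := congrArg (fun a : ℤ => (a : ℚ)) h
  push_cast at h'
  rw [← h']
  congr 2
  ext ℓ
  simp [IsHyperbolicVec]

end Mass

section Bridge

variable {A A' K : Matrix (Fin 3) (Fin 3) ℚ} {T T' TK : Matrix (Fin 3) (Fin 3) ℤ}

lemma intMap_congr_polar (h : intMap TK = (2 : ℚ) • K) (B : Matrix (Fin 3) (Fin 3) ℤ) :
    intMap (Bᵀ * TK * B) = (2 : ℚ) • ((intMap B)ᵀ * K * intMap B) := by
  rw [intMap_mul, intMap_mul, intMap_transpose, h, Matrix.mul_smul, Matrix.smul_mul]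

lemma intMap_smul_polar (h : intMap TK = (2 : ℚ) • K) (k : ℤ) :
    intMap (k • TK) = (2 : ℚ) • ((k : ℚ) • K) := by
  rw [intMap_smul, h, smul_comm]

lemma intMap_one : intMap 1 = 1 := map_one (Int.castRingHom ℚ).mapMatrix

lemma PosDef3.congr (hK : PosDef3 K) {B : Matrix (Fin 3) (Fin 3) ℤ} (hB : B.det ≠ 0) :
    PosDef3 ((intMap B)ᵀ * K * intMap B) := by
  refine ⟨isSymm_congr hK.1 _, fun x hx => ?_⟩
  rw [dotProduct_mulVec_congr]
  refine hK.2 _ fun h0 => hx ?_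
  have hd : (intMap B).det ≠ 0 := by
    rw [intMap_det]
    exact_mod_cast hB
  exact mulVec_injective_of_det_ne_zero hd (by rw [h0, mulVec_zero])

lemma HalfIntegral.congr (hK : PosDef3 K) (hKh : HalfIntegral K)
    (B : Matrix (Fin 3) (Fin 3) ℤ) : HalfIntegral ((intMap B)ᵀ * K * intMap B) := by
  constructor
  · intro i
    obtain ⟨k, hk⟩ := exists_qf_eq_int hK hKh fun j => B j i
    refine ⟨k, hk ▸ ?_⟩
    rw [qf, Matrix.mul_assoc, Matrix.mul_apply]
    simp only [dotProduct, transpose_apply, intMap_apply, mulVec, Matrix.mul_apply]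
  · obtain ⟨TK, -, hTK⟩ := exists_polar hK hKh
    intro i j
    refine ⟨(Bᵀ * TK * B) i j, ?_⟩
    have := congrFun (congrFun (intMap_congr_polar hTK B) i) j
    rw [intMap_apply] at this
    rw [this, Matrix.smul_apply, smul_eq_mul]

lemma autNum_eq_card_automorph (h : intMap T = (2 : ℚ) • A) :
    autNum A = Nat.card (Automorph T) :=
  Nat.card_congr (Equiv.subtypeEquivRight fun X => and_congr_right fun _ =>
    congr_iff_polar h h X)

lemma rEval_eq_card (h : intMap T = (2 : ℚ) • A) (n : ℤ) :
    rEval A n = Nat.card {x : Fin 3 → ℤ // x ⬝ᵥ T *ᵥ x = 2 * n} :=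
  Nat.card_congr (Equiv.subtypeEquivRight fun x => qf_eq_iff h x n)

lemma zEquiv_iff (h : intMap T = (2 : ℚ) • A) (h' : intMap T' = (2 : ℚ) • A') :
    ZEquiv A A' ↔ ∃ X : Matrix (Fin 3) (Fin 3) ℤ, IsUnit X.det ∧ Xᵀ * T * X = T' :=
  exists_congr fun X => and_congr_right fun _ => congr_iff_polar h h' X

variable {p : ℕ} [Fact p.Prime]

lemma isRadicalBasis_iff (hp : p ≠ 2) (hA : PosDef3 A) (hAh : HalfIntegral A) (hT : T.IsSymm)
    (h : intMap T = (2 : ℚ) • A) (Y : Matrix (Fin 3) (Fin 3) ℤ) :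
    IsRadicalBasis p T Y ↔ ∀ x, x ∈ LamSet p A ↔ ∃ c, x = Y *ᵥ c :=
  forall_congr' fun x => by rw [mem_LamSet_iff hp hA hAh hT h]

/-- A form whose Watson transform is `K` embeds into `K` with index `p`. -/
lemma exists_embedding_of_watson (hp : p ≠ 2) (hA : PosDef3 A) (hAh : HalfIntegral A)
    (hTs : T.IsSymm) (h : intMap T = (2 : ℚ) • A) (hTK : intMap TK = (2 : ℚ) • K)
    (hT : IsModHyperbolic p T)
    (hlam : ∀ Y : Matrix (Fin 3) (Fin 3) ℤ, (∀ x, x ∈ LamSet p A ↔ ∃ c, x = Y *ᵥ c) →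
      ZEquiv (((p : ℚ) ^ 2)⁻¹ • ((intMap Y)ᵀ * A * intMap Y)) K) :
    ∃ Z : Matrix (Fin 3) (Fin 3) ℤ, Zᵀ * TK * Z = T ∧ Z.det.natAbs = p := by
  obtain ⟨Y, -, hY⟩ := hT.exists_isRadicalBasis
  obtain ⟨V, hV, hVK⟩ := hlam Y ((isRadicalBasis_iff hp hA hAh hTs h Y).mp hY)
  refine (hY.mul_unimodular hV).exists_embedding hT ?_
  have hp0 : ((p : ℚ) ^ 2) ≠ 0 := pow_ne_zero _ (by exact_mod_cast (Fact.out : p.Prime).ne_zero)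
  have h1 := intMap_smul_polar hTK ((p : ℤ) ^ 2)
  rw [← congr_iff_polar h h1, intMap_mul]
  refine congr_mul rfl ?_
  rw [← hVK, Matrix.mul_smul, Matrix.smul_mul, smul_smul]
  push_cast
  rw [mul_inv_cancel₀ hp0, one_smul]

/-- The Watson transform of an index-`p` sublattice of `K` that is locally hyperbolic is `K`. -/
lemma watson_of_embedding (hp : p ≠ 2) (hK : PosDef3 K) (hKh : HalfIntegral K)
    (hTKs : TK.IsSymm) (hTK : intMap TK = (2 : ℚ) • K) {B : Matrix (Fin 3) (Fin 3) ℤ}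
    (hB : B.det.natAbs = p) (hT : IsModHyperbolic p (Bᵀ * TK * B))
    {Y : Matrix (Fin 3) (Fin 3) ℤ}
    (hY : ∀ x, x ∈ LamSet p ((intMap B)ᵀ * K * intMap B) ↔ ∃ c, x = Y *ᵥ c) :
    ZEquiv (((p : ℚ) ^ 2)⁻¹ • ((intMap Y)ᵀ * ((intMap B)ᵀ * K * intMap B) * intMap Y)) K := by
  have hB0 : B.det ≠ 0 := natAbs_det_ne_zero (p := p) (k := 1) (by rwa [pow_one])
  have hY' : IsRadicalBasis p (Bᵀ * TK * B) Y :=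
    (isRadicalBasis_iff hp (hK.congr hB0) (hKh.congr hK B) (isSymm_congr hTKs B)
      (intMap_congr_polar hTK B) Y).mpr hY
  obtain ⟨U, hU, hBY⟩ := hY'.mul_eq_smul_unimodular hT rfl hB
  refine ⟨U⁻¹, isUnit_nonsing_inv_det _ hU, ?_⟩
  have hp0 : (p : ℚ) ≠ 0 := by exact_mod_cast (Fact.out : p.Prime).ne_zero
  have h1 : ((p : ℚ) ^ 2)⁻¹ • ((intMap Y)ᵀ * ((intMap B)ᵀ * K * intMap B) * intMap Y)
      = (intMap U)ᵀ * K * intMap U := by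
    rw [← congr_mul rfl rfl, ← intMap_mul, hBY, intMap_smul, transpose_smul]
    simp only [Matrix.smul_mul, Matrix.mul_smul, smul_smul]
    push_cast
    rw [inv_mul_eq_div, ← sq, div_self (pow_ne_zero 2 hp0), one_smul]
  rw [h1, ← congr_mul rfl rfl, ← intMap_mul, mul_nonsing_inv _ hU, intMap_one]
  simp

end Bridge

/-- Let `p` be odd, `m ≥ 2`, and `L` a positive definite half-integral ternary form with
Gram matrix ℤ_p-equivalent to `H ⊕ [p^m ε]`, with Watson transform `K = λ_p(L)`
(so `Yᵀ L Y = p² K` for a basis `Y` of `Λ_p(L)`).  If `L₁,…,L_g` are class representatives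
of the forms in the genus of `L` whose λ_p-transform is isometric to `K`, then for
`p ∤ n`: `∑_i r(n,L_i)/o(L_i) = c · r(n,K)/o(K)` with
`c = (p − ((−n d_K)/p))/2` for `m = 2` and `c = p` for `m ≥ 3`. -/
theorem stmt_14 (p : ℕ) [Fact p.Prime] (hp2 : p ≠ 2) (ε : ℤ_[p]ˣ) (m : ℕ) (hm : 2 ≤ m)
    (L : Matrix (Fin 3) (Fin 3) ℚ) (hL : PosDef3 L) (hLh : HalfIntegral L)
    (hLp : ZpEquivTo p L (Hblock p ((p : ℚ_[p]) ^ m * ((ε : ℤ_[p]) : ℚ_[p]))))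
    (K : Matrix (Fin 3) (Fin 3) ℚ) (hK : PosDef3 K) (hKh : HalfIntegral K)
    (YK : Matrix (Fin 3) (Fin 3) ℤ)
    (hYK : ∀ x, x ∈ LamSet p L ↔ ∃ c, x = YK.mulVec c)
    (hKgram : (intMap YK)ᵀ * L * intMap YK = (p : ℚ) ^ 2 • K)
    (g : ℕ) (Ls : Fin g → Matrix (Fin 3) (Fin 3) ℚ)
    (hLs : ∀ i, PosDef3 (Ls i) ∧ HalfIntegral (Ls i))
    (hLsne : ∀ i j, i ≠ j → ¬ ZEquiv (Ls i) (Ls j))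
    (hLsloc : ∀ i, ∀ q : ℕ, ∀ hq : q.Prime, @ZqEquiv q ⟨hq⟩ (Ls i) L)
    (hLslam : ∀ i, ∀ Y : Matrix (Fin 3) (Fin 3) ℤ,
      (∀ x, x ∈ LamSet p (Ls i) ↔ ∃ c, x = Y.mulVec c) →
      ZEquiv (((p : ℚ) ^ 2)⁻¹ • ((intMap Y)ᵀ * Ls i * intMap Y)) K)
    (hLscomp : ∀ A : Matrix (Fin 3) (Fin 3) ℚ, PosDef3 A → HalfIntegral A →
      (∀ q : ℕ, ∀ hq : q.Prime, @ZqEquiv q ⟨hq⟩ A L) →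
      (∀ Y : Matrix (Fin 3) (Fin 3) ℤ,
        (∀ x, x ∈ LamSet p A ↔ ∃ c, x = Y.mulVec c) →
        ZEquiv (((p : ℚ) ^ 2)⁻¹ • ((intMap Y)ᵀ * A * intMap Y)) K) →
      ∃ i, ZEquiv A (Ls i))
    (DK4 : ℤ) (hDK4 : (DK4 : ℚ) = 4 * K.det) :
    (∀ x ∈ LamSet p L, ∃ k : ℤ, qf L x = (p : ℚ) ^ 2 * k) ∧
    ∀ n : ℤ, 0 < n → ¬ (p : ℤ) ∣ n →
      ∑ i, (rEval (Ls i) n : ℚ) / (autNum (Ls i) : ℚ)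
        = (if m = 2 then ((p : ℚ) - (legendreSym p (-(n * DK4)) : ℚ)) / 2 else (p : ℚ))
            * (rEval K n : ℚ) / (autNum K : ℚ) := by
  have hp : p.Prime := Fact.out
  obtain ⟨TL, hTLs, hTL⟩ := exists_polar hL hLh
  obtain ⟨TK, hTKs, hTK⟩ := exists_polar hK hKh
  choose T hTs hT using fun i => exists_polar (hLs i).1 (hLs i).2
  have hcast : (p : ℚ_[p]) ^ m * ((ε : ℤ_[p]) : ℚ_[p])
      = (((p : ℤ_[p]) ^ m * ε : ℤ_[p]) : ℚ_[p]) := by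
    push_cast
    rfl
  rw [hcast] at hLp
  set c : ℤ_[p] := 2 * ((p : ℤ_[p]) ^ m * ε) with hcdef
  have hc : PadicInt.toZMod c = 0 := by
    have : m ≠ 0 := by omega
    simp [hcdef, this]
  have hLloc : IsLocHyperbolic p c TL := (zpEquivTo_Hblock_iff hTL _).mp hLp
  have hTloc : ∀ i, IsLocHyperbolic p c (T i) := fun i => by
    obtain ⟨X, hX, hXT⟩ := (zqEquiv_iff (hT i) hTL).mp (hLsloc i p hp)
    exact hLloc.of_padic_congr hX hXT
  have hTKp : intMap ((p : ℤ) ^ 2 • TK) = (2 : ℚ) • ((p : ℚ) ^ 2 • K) := by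
    rw [intMap_smul_polar hTK]
    push_cast
    rfl
  obtain ⟨ZL, hZL, hdL⟩ := ((isRadicalBasis_iff hp2 hL hLh hTLs hTL YK).mpr hYK).exists_embedding
    (hLloc.isModHyperbolic hc) ((congr_iff_polar hTL
      hTKp YK).mp hKgram)
  choose Z hZ hdZ using fun i => exists_embedding_of_watson hp2 (hLs i).1 (hLs i).2 (hTs i) (hT i)
    hTK ((hTloc i).isModHyperbolic hc) (hLslam i)
  have hdetK : TK.det = 2 * DK4 := by
    have h1 := congrArg det hTK
    rw [intMap_det, det_smul, Fintype.card_fin] at h1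
    have h2 : ((TK.det : ℤ) : ℚ) = ((2 * DK4 : ℤ) : ℚ) := by
      rw [h1]
      push_cast
      rw [hDK4]
      ring
    exact_mod_cast h2
  have hK0 : TK.det ≠ 0 := by
    intro h0
    have h1 := congrArg det hTK
    rw [intMap_det, h0, det_smul] at h1
    exact hK.det_ne_zero (by simpa using h1.symm)
  have hoK : Nat.card (Automorph TK) ≠ 0 := by
    rw [← autNum_eq_card_automorph hTK]
    exact hK.autNum_ne_zero
  obtain ⟨w, hw, hwdet⟩ : ∃ w : ℤ_[p], IsUnit w ∧
      (TK.det : ℤ_[p]) = -(w ^ 2 * (2 * ((p : ℤ_[p]) ^ (m - 2) * ε))) := by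
    obtain ⟨w, hw, hwdet⟩ := hLloc.exists_det_eq
    refine ⟨w, hw, ?_⟩
    have h1 : ZL.det ^ 2 = (p : ℤ) ^ 2 := Int.natAbs_eq_iff_sq_eq.mp (by simpa using hdL)
    have h2 : (p : ℤ) ^ 2 * TK.det = TL.det := by
      rw [← hZL, det_mul, det_mul, det_transpose, ← h1]
      ring
    rw [← h2, hcdef, ← Nat.sub_add_cancel hm, pow_add] at hwdet
    have hp0 : (p : ℤ_[p]) ^ 2 ≠ 0 := pow_ne_zero _ (by exact_mod_cast hp.ne_zero)
    apply mul_left_cancel₀ hp0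
    push_cast at hwdet ⊢
    rw [hwdet]
    ring
  have hmod : (modMat p TK).det = PadicInt.toZMod (TK.det : ℤ_[p]) := by
    rw [modMat_det, map_intCast]
  refine ⟨fun x hx => ?_, fun n _ hn => ?_⟩
  · obtain ⟨v, rfl⟩ := (hYK x).mp hx
    obtain ⟨k, hk⟩ := exists_qf_eq_int hK hKh v
    refine ⟨k, ?_⟩
    rw [← hk, qf, ← intMap_mulVec, ← dotProduct_mulVec_congr, hKgram, smul_mulVec,
      dotProduct_smul, smul_eq_mul, qf]
  · have hmass := sum_div_card_automorph hp2 hTKs hK0 hoK hc hLloc hZL hdL hTloc hZ hdZ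
      (fun i j W hW hWT => by
        by_contra hij
        exact hLsne i j hij ((zEquiv_iff (hT i) (hT j)).mpr ⟨W, hW, hWT⟩))
      (fun B hB hBloc => by
        have hB0 : B.det ≠ 0 := natAbs_det_ne_zero (p := p) (k := 1) (by rwa [pow_one])
        have hTB := intMap_congr_polar hTK B
        obtain ⟨i, hi⟩ := hLscomp _ (hK.congr hB0) (hKh.congr hK B) (fun q hq => by
            have : Fact q.Prime := ⟨hq⟩
            rw [zqEquiv_iff hTB hTL]
            rcases eq_or_ne q p with hqp | hqp
            · subst hqp
              exact hBloc.exists_padic_congr hLloc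
            · rw [← hZL]
              exact exists_padic_congr_of_embeddings hqp hB hdL)
          fun Y hY => watson_of_embedding hp2 hK hKh hTKs hTK hB (hBloc.isModHyperbolic hc) hY
        exact ⟨i, (zEquiv_iff hTB (hT i)).mp hi⟩)
      (2 * n)
    have hfin : Finite {v : Fin 3 → ℤ // v ⬝ᵥ TK *ᵥ v = 2 * n} :=
      have := hK.finite_rep n
      Finite.of_equiv _ (Equiv.subtypeEquivRight fun x => qf_eq_iff hTK x n)
    have hp1 : (p : ℚ) - 1 ≠ 0 := by
      rw [sub_ne_zero]
      exact_mod_cast hp.one_lt.ne'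
    have hoK' : (Nat.card (Automorph TK) : ℚ) ≠ 0 := by exact_mod_cast hoK
    simp only [rEval_eq_card hTK, autNum_eq_card_automorph hTK, fun i => rEval_eq_card (hT i) n,
      fun i => autNum_eq_card_automorph (hT i)]
    rw [eq_div_iff hoK']
    apply mul_right_cancel₀ hp1
    rw [mul_assoc, hmass]
    split_ifs with hm2
    · have hdet0 : (modMat p TK).det ≠ 0 := by
        rw [hmod, ← padicInt_isUnit_iff_toZMod_ne_zero, hwdet, hm2]
        simpa using (hw.pow 2).mul ((padicInt_isUnit_two hp2).mul ε.isUnit)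
      rw [sum_card_solutions_swap fun v hv =>
        card_isHyperbolicVec_of_det_ne_zero hp2 hTKs hn hdetK hdet0 hv]
      ring
    · have hdet0 : (modMat p TK).det = 0 := by
        have : m - 2 ≠ 0 := by omega
        rw [hmod, hwdet]
        simp [this]
      obtain ⟨ℓ₀, h0, hℓ₀⟩ := exists_vecMul_eq_zero_iff_smul hdL
      have hgood : IsHyperbolicVec TK ℓ₀ :=
        IsNeighborVec.isHyperbolicVec hK0 (hLloc.isModHyperbolic hc) hZL hdL
          ⟨h0, ZL, hZL, (hℓ₀ ℓ₀).mpr ⟨1, (one_smul _ _).symm⟩⟩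
      rw [sum_card_solutions_swap fun v hv =>
        card_isHyperbolicVec_of_det_eq_zero hp2 hTKs hn hdet0 hgood hv]
      ring
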